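/- arXiv:2509.20274 — 7 statements merged into one kernel-verified Lean document; each statement's English description precedes it below -/
import Mathlib

section
/- A finite poset P is an interval order (i.e., there exist functions ℓ, r : P → ℝ with ℓ(x) ≤ r(x) for all x, such that x < y in P if and only if r(x) < ℓ(y)) if and only if P does not contain 2+2 as a subposet, i.e., there do not exist four distinct elements a, b, c, d with a < b, c < d, and each of a, b incomparable to each of c, d. -/
/-- `x` and `y` are incomparable in the strict order. -/
def Incomp {α : Type*} [Preorder α] (x y : α) : Prop := ¬ x < y ∧ ¬ y < x

/-- A finite poset is an interval order (admits an interval representation with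
`ℓ x ≤ r x` and `x < y ↔ r x < ℓ y`) if and only if it contains no `2 + 2`. -/
theorem interval_order_iff_no_two_plus_two {α : Type*} [Fintype α] [PartialOrder α] :
    (∃ (l r : α → ℝ), (∀ x, l x ≤ r x) ∧ (∀ x y, x < y ↔ r x < l y)) ↔
      ¬ ∃ a b c d : α,
        a ≠ b ∧ a ≠ c ∧ a ≠ d ∧ b ≠ c ∧ b ≠ d ∧ c ≠ d ∧
        a < b ∧ c < d ∧
        Incomp a c ∧ Incomp a d ∧ Incomp b c ∧ Incomp b d := by
  classical
  constructor
  · rintro ⟨l, r, -, h⟩ ⟨a, b, c, d, -, -, -, -, -, -, hab, hcd, -, had, hbc, -⟩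
    have h1 := (h a b).1 hab
    have h2 := (h c d).1 hcd
    have h3 := had.1
    have h4 := hbc.2
    rw [h] at h3 h4
    linarith
  · intro h
    let D : α → Finset α := fun x => Finset.univ.filter (fun z => z < x)
    let N : α → Finset α := fun x => Finset.univ.filter (fun z => ¬ x < z)
    have hle : ∀ x z, ¬ x < z → (D z).card ≤ (N x).sup (fun y => (D y).card) := by
      intro x z hz
      exact Finset.le_sup (f := fun y => (D y).card) (by simpa [N] using hz)
    refine ⟨fun x => ((D x).card : ℝ),
      fun x => (((N x).sup (fun y => (D y).card) : ℕ) : ℝ), ?_, ?_⟩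
    · intro x
      exact Nat.cast_le.2 (hle x x (lt_irrefl x))
    · intro x y
      rw [Nat.cast_lt]
      constructor
      · intro hxy
        have hpos : 0 < (D y).card := Finset.card_pos.2 ⟨x, by simpa [D] using hxy⟩
        rw [Finset.sup_lt_iff (by simpa using hpos)]
        intro z hz
        have hxz : ¬ x < z := by simpa [N] using hz
        apply Finset.card_lt_card
        rw [Finset.ssubset_iff_of_subset]
        · exact ⟨x, by simpa [D] using hxy, by simpa [D] using hxz⟩
        · intro w hw
          have hwz : w < z := by simpa [D] using hw
          suffices w < y by simpa [D] using this
          by_contra hwy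
          refine h ⟨x, y, w, z, hxy.ne, ?_, ?_, ?_, ?_, hwz.ne, hxy, hwz,
            ⟨fun e => hxz (e.trans hwz), fun e => hwy (e.trans hxy)⟩,
            ⟨hxz, fun e => hwy (hwz.trans (e.trans hxy))⟩,
            ⟨fun e => hxz (hxy.trans (e.trans hwz)), hwy⟩,
            ⟨fun e => hxz (hxy.trans e), fun e => hwy (hwz.trans e)⟩⟩
          · rintro rfl; exact hxz hwz
          · rintro rfl; exact hwy (hwz.trans hxy)
          · rintro rfl; exact hxz (hxy.trans hwz)
          · rintro rfl; exact hxz hxy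
      · intro hlt
        by_contra hxy
        exact absurd (hle x y hxy) (not_le.2 hlt)
end

section
/- Let P be a finite semiorder and let x, y be distinct elements of P that are not twins (i.e., D(x) ≠ D(y) or U(x) ≠ U(y)). Then for any two unit interval representations f and g of P, one has f(x) < f(y) if and only if g(x) < g(y); in other words, either f(x) < f(y) in every representation f, or f(x) > f(y) in every representation f. -/
/-- A unit interval representation of a poset. -/
def UnitRep {α : Type*} [Preorder α] (f : α → ℝ) : Prop :=
  ∀ x y : α, x < y ↔ f x + 1 < f y

/-- A poset is a semiorder if it admits a unit interval representation. -/
def IsSemiorder (α : Type*) [Preorder α] : Prop :=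
  ∃ f : α → ℝ, UnitRep f

/-- If `x` and `y` are distinct non-twin elements of a finite semiorder, then the
relative order of `f x` and `f y` is the same in every unit interval representation. -/
theorem non_twins_same_order_in_every_representation
    {α : Type*} [Fintype α] [PartialOrder α] (hP : IsSemiorder α)
    (x y : α) (hxy : x ≠ y)
    (hnt : ¬ ({z : α | z < x} = {z : α | z < y} ∧ {z : α | x < z} = {z : α | y < z}))
    (f g : α → ℝ) (hf : UnitRep f) (hg : UnitRep g) :
    f x < f y ↔ g x < g y := by
  by_contra hcon
  apply hnt
  constructor
  · ext z
    simp only [Set.mem_setOf_eq]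
    by_contra h
    have h1 := hf z x
    have h2 := hf z y
    have h3 := hg z x
    have h4 := hg z y
    grind
  · ext z
    simp only [Set.mem_setOf_eq]
    by_contra h
    have h1 := hf x z
    have h2 := hf y z
    have h3 := hg x z
    have h4 := hg y z
    grind
end

section
/- Let P be a finite semiorder with n elements. Then there exists an enumeration x_1, …, x_n of the elements of P (a bijection from {1,…,n} to P) such that: (i) it is a linear extension, i.e., if x_i < x_j in P then i < j; (ii) in each set of pairwise twins, all elements occupy consecutive positions, i.e., if i < j < k and x_i, x_k are twins, then x_i and x_j are twins; and (iii) if i < j and x_i, x_j are not twins, then f(x_i) < f(x_j) for every unit interval representation f of P. -/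
/-- Two distinct elements are twins if they have the same downset and the same upset. -/
def Twins {α : Type*} [Preorder α] (x y : α) : Prop :=
  x ≠ y ∧ {z : α | z < x} = {z : α | z < y} ∧ {z : α | x < z} = {z : α | y < z}

/-- Every finite semiorder has an endpoint linear extension: a linear extension in
which twins are consecutive, and non-twins appear in the order of their left
endpoints in every unit interval representation. -/
theorem exists_endpoint_linear_extension
    {α : Type*} [Fintype α] [PartialOrder α] (hP : IsSemiorder α)
    (n : ℕ) (hn : Fintype.card α = n) :
    ∃ e : Fin n ≃ α,
      (∀ i j : Fin n, e i < e j → i < j) ∧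
      (∀ i j k : Fin n, i < j → j < k → Twins (e i) (e k) → Twins (e i) (e j)) ∧
      (∀ i j : Fin n, i < j → ¬ Twins (e i) (e j) →
        ∀ f : α → ℝ, UnitRep f → f (e i) < f (e j)) := by
  obtain ⟨g, hg⟩ := hP
  let e0 : Fin n ≃ α := (Fintype.equivFinOfCardEq hn).symm
  let e : Fin n ≃ α := (Tuple.sort (g ∘ e0)).trans e0
  have hm : ∀ i j : Fin n, i ≤ j → g (e i) ≤ g (e j) := fun i j hij =>
    Tuple.monotone_sort (g ∘ e0) hij
  have hD : ∀ i j : Fin n, i ≤ j → ∀ z, z < e i → z < e j := by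
    intro i j hij z hz
    rw [hg] at hz ⊢
    linarith [hm i j hij]
  have hU : ∀ i j : Fin n, i ≤ j → ∀ z, e j < z → e i < z := by
    intro i j hij z hz
    rw [hg] at hz ⊢
    linarith [hm i j hij]
  refine ⟨e, ?_, ?_, ?_⟩
  · intro i j hij
    by_contra hc
    have h1 := hm j i (not_lt.mp hc)
    have h2 := (hg _ _).1 hij
    linarith
  · rintro i j k hij hjk ⟨-, h1, h2⟩
    refine ⟨fun h => hij.ne (e.injective h), ?_, ?_⟩
    · ext z
      exact ⟨hD i j hij.le z, fun hz => (Set.ext_iff.1 h1 z).2 (hD j k hjk.le z hz)⟩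
    · ext z
      exact ⟨fun hz => hU j k hjk.le z ((Set.ext_iff.1 h2 z).1 hz), hU i j hij.le z⟩
  · intro i j hij hT f hf
    by_contra hc
    refine hT ⟨fun h => hij.ne (e.injective h), ?_, ?_⟩
    · ext z
      refine ⟨hD i j hij.le z, fun hz => ?_⟩
      have hz' := (hf _ _).1 hz
      exact (hf _ _).2 (by linarith)
    · ext z
      refine ⟨fun hz => ?_, hU i j hij.le z⟩
      have hz' := (hf _ _).1 hz
      exact (hf _ _).2 (by linarith)
end

section
/- Let P₁, …, P_k be finite semiorders that are bricks, with |P_i| = n_i and n = n₁ + ⋯ + n_k, and let P be their lexicographic sum over the k-chain. For each i, let c_i > 0 be the constant with lim_{L→∞} V_{P_i}(L)/L = c_i. Then there exist a real polynomial E of degree strictly less than k and a real L₀ such that for all L ≥ L₀, V_P(L) = (n! / (n₁!·n₂!·⋯·n_k!)) · (c₁ c₂ ⋯ c_k / k!) · L^k + E(L). -/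
open MeasureTheory Set Filter

/-- A poset is a brick if its ground set cannot be partitioned into two nonempty
parts `A`, `B` with every element of `A` below every element of `B`. -/
def IsBrick (α : Type*) [Preorder α] : Prop :=
  ¬ ∃ A B : Set α, A.Nonempty ∧ B.Nonempty ∧ (∀ x, x ∈ A ∨ x ∈ B) ∧
      (∀ x, ¬ (x ∈ A ∧ x ∈ B)) ∧ ∀ a ∈ A, ∀ b ∈ B, a < b

/-- `genVol r L` is the volume of the set of tuples `x ∈ [0,L]^α` such that the
relation `i ≺ j ↔ x i + 1 < x j` on the index set is isomorphic to `r`. -/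
noncomputable def genVol {α : Type*} [Fintype α] (r : α → α → Prop) (L : ℝ) : ℝ :=
  (volume {x : α → ℝ | (∀ i, x i ∈ Icc (0:ℝ) L) ∧
      ∃ e : α ≃ α, ∀ a b : α, r a b ↔ x (e a) + 1 < x (e b)}).toReal


lemma poly_antideriv (p : Polynomial ℝ) (k : ℕ) (hp : p.natDegree ≤ k) :
    ∃ Q : Polynomial ℝ, Polynomial.derivative Q = p ∧ Q.natDegree ≤ k + 1 ∧
      Q.coeff (k + 1) = p.coeff k / (k + 1) := by
  refine ⟨∑ i ∈ Finset.range (k + 1), Polynomial.monomial (i + 1) (p.coeff i / (i + 1)), ?_, ?_, ?_⟩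
  · rw [Polynomial.derivative_sum]
    conv_rhs => rw [p.as_sum_range' (k + 1) (by omega)]
    refine Finset.sum_congr rfl fun i _ => ?_
    rw [Polynomial.derivative_monomial]
    congr 1
    push_cast
    field_simp
  · refine Polynomial.natDegree_sum_le_of_forall_le _ _ fun i hi => ?_
    refine (Polynomial.natDegree_monomial_le _).trans ?_
    have := Finset.mem_range.1 hi
    omega
  · rw [Polynomial.finsetSum_coeff, Finset.sum_eq_single k]
    · simp
    · intro b _ hb
      rw [Polynomial.coeff_monomial, if_neg (by omega)]
    · simp

lemma poly_avg {Ω : Type*} [MeasurableSpace Ω] (μ : Measure Ω) [IsFiniteMeasure μ]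
    (s : Ω → ℝ) (hs : Measurable s) (N : ℝ) (hN : ∀ᵐ ω ∂μ, 0 ≤ s ω ∧ s ω ≤ N)
    (Q : Polynomial ℝ) (k : ℕ) (hQ : Q.natDegree ≤ k) :
    ∃ q : Polynomial ℝ, q.natDegree ≤ k ∧ q.coeff k = μ.real univ * Q.coeff k ∧
      ∀ L, ∫ ω, Q.eval (L - s ω) ∂μ = q.eval L := by
  have hint : ∀ R : Polynomial ℝ, Integrable (fun ω => R.eval (-s ω)) μ := by
    intro R
    have hc : Continuous fun t : ℝ => R.eval (-t) := R.continuous.comp continuous_neg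
    obtain ⟨C, hC⟩ := (isCompact_Icc (a := (0:ℝ)) (b := N)).exists_bound_of_continuousOn
      hc.continuousOn
    refine Integrable.of_bound (hc.measurable.comp hs).aestronglyMeasurable C ?_
    filter_upwards [hN] with ω hω
    exact hC _ hω
  refine ⟨∑ j ∈ Finset.range (k + 1), Polynomial.monomial j
    (∫ ω, (Polynomial.hasseDeriv j Q).eval (-s ω) ∂μ), ?_, ?_, ?_⟩
  · refine Polynomial.natDegree_sum_le_of_forall_le _ _ fun i hi => ?_
    refine (Polynomial.natDegree_monomial_le _).trans ?_
    have := Finset.mem_range.1 hi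
    omega
  · rw [Polynomial.finsetSum_coeff, Finset.sum_eq_single k]
    · have : Polynomial.hasseDeriv k Q = Polynomial.C (Q.coeff k) := by
        ext n
        rw [Polynomial.hasseDeriv_coeff, Polynomial.coeff_C]
        split_ifs with h
        · subst h; simp
        · rw [Polynomial.coeff_eq_zero_of_natDegree_lt (by omega), mul_zero]
      simp [this]
    · intro b _ hb
      rw [Polynomial.coeff_monomial, if_neg (by omega)]
    · simp
  · intro L
    have : ∀ ω, Q.eval (L - s ω) = ∑ j ∈ Finset.range (k + 1),
        (Polynomial.hasseDeriv j Q).eval (-s ω) * L ^ j := by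
      intro ω
      rw [sub_eq_add_neg, ← Polynomial.taylor_eval,
        Polynomial.eval_eq_sum_range' (n := k + 1) (by rw [Polynomial.natDegree_taylor]; omega)]
      simp [Polynomial.taylor_coeff]
    simp_rw [this]
    rw [integral_finsetSum _ fun j _ => (hint _).mul_const _, Polynomial.eval_finsetSum]
    refine Finset.sum_congr rfl fun j _ => ?_
    rw [integral_mul_const, Polynomial.eval_monomial]

lemma step_poly {Ω : Type*} [MeasurableSpace Ω] (μ : Measure Ω) [IsFiniteMeasure μ]
    (s : Ω → ℝ) (hs : Measurable s) (N : ℝ) (hN : ∀ᵐ ω ∂μ, 0 ≤ s ω ∧ s ω ≤ N)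
    (F : ℝ → ENNReal) (hF : Monotone F) (hfin : ∀ t, F t ≠ ⊤)
    (p : Polynomial ℝ) (k : ℕ) (hp : p.natDegree ≤ k) (T : ℝ)
    (hFp : ∀ t ≥ T, (F t).toReal = p.eval t) :
    ∃ q : Polynomial ℝ, q.natDegree ≤ k + 1 ∧
      q.coeff (k + 1) = μ.real univ * (p.coeff k / (k + 1)) ∧ ∃ T' : ℝ, ∀ L ≥ T',
      (∫⁻ ω, (∫⁻ u in Ico (0:ℝ) (L - s ω), F (u - 1)) ∂μ).toReal = q.eval L := by
  set f : ℝ → ℝ := fun u => (F (u - 1)).toReal with hf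
  have hfm : Monotone f := fun a b hab =>
    ENNReal.toReal_mono (hfin _) (hF (by linarith))
  have hfi : ∀ a b, IntervalIntegrable f volume a b := fun a b => hfm.intervalIntegrable
  set T₁ : ℝ := max (T + 1) 0 with hT₁
  obtain ⟨Q, hQd, hQn, hQc⟩ := poly_antideriv (p.comp (Polynomial.X - Polynomial.C 1)) k (by
    rw [Polynomial.natDegree_comp, Polynomial.natDegree_X_sub_C, mul_one]; exact hp)
  have hcoef : (p.comp (Polynomial.X - Polynomial.C 1)).coeff k = p.coeff k := by
    have h1 : p.comp (Polynomial.X - Polynomial.C 1) = Polynomial.taylor (-1) p := by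
      rw [Polynomial.taylor_apply]; simp [sub_eq_add_neg]
    have : Polynomial.hasseDeriv k p = Polynomial.C (p.coeff k) := by
      ext n
      rw [Polynomial.hasseDeriv_coeff, Polynomial.coeff_C]
      split_ifs with h
      · subst h; simp
      · rw [Polynomial.coeff_eq_zero_of_natDegree_lt (by omega), mul_zero]
    rw [h1, Polynomial.taylor_coeff, this]; simp
  set Q' : Polynomial ℝ := Q + Polynomial.C ((∫ u in (0:ℝ)..T₁, f u) - Q.eval T₁) with hQ'
  have hK : ∀ t ≥ T₁, ∫ u in (0:ℝ)..t, f u = Q'.eval t := by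
    intro t ht
    rw [← intervalIntegral.integral_add_adjacent_intervals (hfi 0 T₁) (hfi T₁ t)]
    have : ∫ u in T₁..t, f u = Q.eval t - Q.eval T₁ := by
      rw [← intervalIntegral.integral_eq_sub_of_hasDerivAt (f := fun x => Q.eval x)
        (f' := fun x => (p.comp (Polynomial.X - Polynomial.C 1)).eval x)]
      · refine intervalIntegral.integral_congr fun u hu => ?_
        rw [uIcc_of_le ht] at hu
        have h2 : T ≤ u - 1 := by
          have := le_max_left (T + 1) 0
          have := hu.1
          linarith
        simp [hf, hFp _ h2]
      · intro x _
        rw [← hQd]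
        exact Q.hasDerivAt x
      · exact (Polynomial.continuous _).intervalIntegrable _ _
    rw [this, hQ']
    simp
    ring
  have hL : ∀ t ≥ 0, ∫⁻ u in Ico 0 t, F (u - 1) = ENNReal.ofReal (∫ u in (0:ℝ)..t, f u) := by
    intro t ht
    rw [intervalIntegral.integral_of_le ht, ← integral_Ico_eq_integral_Ioc,
      ofReal_integral_eq_lintegral_ofReal]
    · refine lintegral_congr fun u => ?_
      rw [hf, ENNReal.ofReal_toReal (hfin _)]
    · have := (intervalIntegrable_iff_integrableOn_Ico_of_le ht (by simp) (by simp)).1 (hfi 0 t)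
      exact this
    · exact Eventually.of_forall fun u => ENNReal.toReal_nonneg
  obtain ⟨q, hq1, hq2, hq3⟩ := poly_avg μ s hs N hN Q' (k + 1) (by
    rw [hQ', Polynomial.natDegree_add_C]; exact hQn)
  refine ⟨q, hq1, ?_, T₁ + N, ?_⟩
  · rw [hq2, hQ', Polynomial.coeff_add, Polynomial.coeff_C, if_neg (by omega), hQc, hcoef, add_zero]
  · intro L hLge
    rw [← hq3, integral_eq_lintegral_of_nonneg_ae]
    · congr 1
      refine lintegral_congr_ae ?_
      filter_upwards [hN] with ω hω
      have h0 : T₁ ≤ L - s ω := by linarith [hω.2]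
      have h1 : (0:ℝ) ≤ L - s ω := (le_max_right _ _).trans h0
      rw [hL _ h1, hK _ h0]
    · filter_upwards [hN] with ω hω
      have h0 : T₁ ≤ L - s ω := by linarith [hω.2]
      have h1 : (0:ℝ) ≤ L - s ω := (le_max_right _ _).trans h0
      rw [Pi.zero_apply, ← hK _ h0]
      exact intervalIntegral.integral_nonneg h1 fun u _ => ENNReal.toReal_nonneg
    · exact ((Polynomial.continuous _).measurable.comp (measurable_const.sub hs)).aestronglyMeasurable

/-- Smallest coordinate. -/
noncomputable def mnc {α : Type*} [Fintype α] [Nonempty α] (x : α → ℝ) : ℝ :=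
  Finset.univ.inf' Finset.univ_nonempty x

/-- Largest coordinate. -/
noncomputable def mxc {α : Type*} [Fintype α] [Nonempty α] (x : α → ℝ) : ℝ :=
  Finset.univ.sup' Finset.univ_nonempty x

/-- Labelled representations. -/
def repSet {α : Type*} (r : α → α → Prop) : Set (α → ℝ) :=
  {x | ∀ a b, r a b ↔ x a + 1 < x b}

section
variable {α : Type*} [Fintype α]

lemma measurable_mnc [Nonempty α] : Measurable (mnc : (α → ℝ) → ℝ) := by
  unfold mnc
  exact (Continuous.finset_inf'_apply _ fun i _ => continuous_apply i).measurable

lemma measurable_mxc [Nonempty α] : Measurable (mxc : (α → ℝ) → ℝ) := by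
  unfold mxc
  exact (Continuous.finset_sup'_apply _ fun i _ => continuous_apply i).measurable

lemma le_mnc_iff [Nonempty α] (x : α → ℝ) (t : ℝ) : t ≤ mnc x ↔ ∀ a, t ≤ x a := by
  simp [mnc]

lemma lt_mnc_iff [Nonempty α] (x : α → ℝ) (t : ℝ) : t < mnc x ↔ ∀ a, t < x a := by
  simp [mnc]

lemma mxc_lt_iff [Nonempty α] (x : α → ℝ) (t : ℝ) : mxc x < t ↔ ∀ a, x a < t := by
  simp [mxc]

lemma exists_mnc [Nonempty α] (x : α → ℝ) : ∃ a, x a = mnc x := by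
  obtain ⟨a, -, h⟩ := Finset.exists_mem_eq_inf' (Finset.univ_nonempty (α := α)) x
  exact ⟨a, h.symm⟩

lemma exists_mxc [Nonempty α] (x : α → ℝ) : ∃ a, x a = mxc x := by
  obtain ⟨a, -, h⟩ := Finset.exists_mem_eq_sup' (Finset.univ_nonempty (α := α)) x
  exact ⟨a, h.symm⟩

lemma mnc_add [Nonempty α] (x : α → ℝ) (u : ℝ) : mnc (x + fun _ => u) = mnc x + u := by
  refine eq_of_forall_le_iff fun t => ?_
  rw [le_mnc_iff, ← sub_le_iff_le_add, le_mnc_iff]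
  simp

lemma mxc_add [Nonempty α] (x : α → ℝ) (u : ℝ) : mxc (x + fun _ => u) = mxc x + u := by
  refine eq_of_forall_gt_iff fun t => ?_
  rw [mxc_lt_iff, ← lt_sub_iff_add_lt, mxc_lt_iff]
  simp [lt_sub_iff_add_lt]

lemma measurableSet_repSet (r : α → α → Prop) : MeasurableSet (repSet r) := by
  have : repSet r = ⋂ a, ⋂ b, {x : α → ℝ | r a b ↔ x a + 1 < x b} := by
    ext; simp [repSet]
  rw [this]
  refine MeasurableSet.iInter fun a => MeasurableSet.iInter fun b => ?_
  have h : MeasurableSet {x : α → ℝ | x a + 1 < x b} :=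
    measurableSet_lt ((measurable_pi_apply a).add_const 1) (measurable_pi_apply b)
  by_cases hr : r a b
  · simpa [hr] using h
  · have h2 : MeasurableSet {x : α → ℝ | x b ≤ x a + 1} :=
      measurableSet_le (measurable_pi_apply b) ((measurable_pi_apply a).add_const 1)
    simpa [hr] using h2

lemma repSet_add (r : α → α → Prop) (x : α → ℝ) (u : ℝ) :
    (x + fun _ => u) ∈ repSet r ↔ x ∈ repSet r := by
  simp only [repSet, mem_ofPred_eq, Pi.add_apply]
  refine forall_congr' fun a => forall_congr' fun b => ?_
  have : x a + u + 1 < x b + u ↔ x a + 1 < x b := by constructor <;> intro h <;> linarith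
  rw [this]

lemma disint [Nonempty α] (r : α → α → Prop) (g : (α → ℝ) → ENNReal) (hg : Measurable g) :
    ∫⁻ x in repSet r, g x =
      ∫⁻ x in repSet r ∩ {x | mnc x ∈ Ico (0:ℝ) 1}, ∫⁻ u : ℝ, g (x + fun _ => u) := by
  have hR := measurableSet_repSet r
  have hW : MeasurableSet {x : α → ℝ | mnc x ∈ Ico (0:ℝ) 1} := measurable_mnc measurableSet_Ico
  set G : (α → ℝ) → ENNReal := (repSet r).indicator g with hG
  have hGm : Measurable G := hg.indicator hR
  set w : (α → ℝ) → ENNReal := {x : α → ℝ | mnc x ∈ Ico (0:ℝ) 1}.indicator 1 with hw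
  have hwm : Measurable w := measurable_one.indicator hW
  have hadd : Measurable fun q : (α → ℝ) × ℝ => (q.1 + fun _ => q.2) := by
    refine measurable_pi_lambda _ fun a => ?_
    exact ((measurable_pi_apply a).comp measurable_fst).add measurable_snd
  have hsub : Measurable fun q : (α → ℝ) × ℝ => (q.1 + fun _ => -q.2) := by
    refine measurable_pi_lambda _ fun a => ?_
    exact ((measurable_pi_apply a).comp measurable_fst).add measurable_snd.neg
  have hw1 : ∀ x, ∫⁻ u : ℝ, w (x + fun _ => -u) = 1 := by
    intro x
    have : (fun u : ℝ => w (x + fun _ => -u)) =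
        (Ioc (mnc x - 1) (mnc x)).indicator 1 := by
      ext u
      simp only [hw, indicator, mem_ofPred_eq, mnc_add, mem_Ico, mem_Ioc, Pi.one_apply]
      congr 1
      apply propext
      constructor <;> rintro ⟨h1, h2⟩ <;> constructor <;> linarith
    rw [this, lintegral_indicator_one measurableSet_Ioc]
    simp
  calc ∫⁻ x in repSet r, g x = ∫⁻ x, G x := (lintegral_indicator hR _).symm
    _ = ∫⁻ x, ∫⁻ u : ℝ, G x * w (x + fun _ => -u) := by
        refine lintegral_congr fun x => ?_
        rw [lintegral_const_mul, hw1, mul_one]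
        exact hwm.comp (hsub.comp measurable_prodMk_left)
    _ = ∫⁻ u : ℝ, ∫⁻ x, G x * w (x + fun _ => -u) := by
        rw [lintegral_lintegral_swap]
        exact ((hGm.comp measurable_fst).mul (hwm.comp hsub)).aemeasurable
    _ = ∫⁻ u : ℝ, ∫⁻ x, G (x + fun _ => u) * w x := by
        refine lintegral_congr fun u => ?_
        rw [← lintegral_add_right_eq_self (fun x => G x * w (x + fun _ => -u)) (fun _ => u)]
        refine lintegral_congr fun x => ?_
        congr 2
        ext a; simp
    _ = ∫⁻ x, ∫⁻ u : ℝ, G (x + fun _ => u) * w x := by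
        rw [lintegral_lintegral_swap]
        exact ((hGm.comp (hadd.comp measurable_swap)).mul (hwm.comp measurable_snd)).aemeasurable
    _ = _ := by
        rw [← lintegral_indicator (hR.inter hW)]
        refine lintegral_congr fun x => ?_
        by_cases hx : x ∈ repSet r
        · by_cases hx' : x ∈ {x : α → ℝ | mnc x ∈ Ico (0:ℝ) 1}
          · rw [indicator_of_mem (mem_inter hx hx')]
            refine lintegral_congr fun u => ?_
            rw [hw, indicator_of_mem hx', hG, indicator_of_mem ((repSet_add r x u).2 hx)]
            simp
          · rw [indicator_of_notMem fun h => hx' h.2]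
            rw [hw, indicator_of_notMem hx']
            simp
        · rw [indicator_of_notMem fun h => hx h.1]
          have : ∀ u : ℝ, G (x + fun _ => u) = 0 := fun u =>
            indicator_of_notMem (fun h => hx ((repSet_add r x u).1 h)) _
          simp [this]
end
lemma mnc_le {α : Type*} [Fintype α] [Nonempty α] (x : α → ℝ) (a : α) : mnc x ≤ x a :=
  (le_mnc_iff x _).1 le_rfl a

lemma mnc_le_mxc {α : Type*} [Fintype α] [Nonempty α] (x : α → ℝ) : mnc x ≤ mxc x := by
  obtain ⟨a, ha⟩ := exists_mxc x
  rw [← ha]; exact mnc_le x a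

lemma le_mxc {α : Type*} [Fintype α] [Nonempty α] (x : α → ℝ) (a : α) : x a ≤ mxc x := by
  by_contra h
  exact lt_irrefl _ ((mxc_lt_iff x _).1 (not_le.1 h) a)

lemma brick_spread {α : Type*} [Fintype α] [Nonempty α] [Preorder α] (hb : IsBrick α)
    (x : α → ℝ) (hx : x ∈ repSet (fun a b : α => a < b)) :
    mxc x - mnc x ≤ Fintype.card α := by
  by_contra hcon
  push Not at hcon
  obtain ⟨a, ha⟩ := exists_mnc x
  obtain ⟨b, hbx⟩ := exists_mxc x
  have key : ∀ j : Fin (Fintype.card α), ∃ c : α, x a + j < x c ∧ x c ≤ x a + j + 1 := by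
    intro j
    by_contra hno
    push Not at hno
    have hj : ((j : ℕ) : ℝ) + 1 ≤ Fintype.card α := by exact_mod_cast j.2
    refine hb ⟨{c | x c ≤ x a + j}, {c | x a + j + 1 < x c}, ⟨a, ?_⟩, ⟨b, ?_⟩, ?_, ?_, ?_⟩
    · simp
    · simp only [mem_ofPred_eq]; linarith
    · intro c
      simp only [mem_ofPred_eq]
      rcases le_or_gt (x c) (x a + j) with h | h
      · exact Or.inl h
      · exact Or.inr (hno c h)
    · intro c
      simp only [mem_ofPred_eq]
      rintro ⟨h1, h2⟩
      linarith
    · intro c hc d hd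
      simp only [mem_ofPred_eq] at hc hd
      exact (hx c d).2 (by linarith)
  choose c hc1 hc2 using key
  have hinj : Function.Injective c := by
    intro i j hij
    have h1 := hc1 i; have h2 := hc2 i; have h3 := hc1 j; have h4 := hc2 j
    rw [hij] at h1 h2
    have h5 : ((i : ℕ) : ℝ) < (j : ℕ) + 1 := by linarith
    have h6 : ((j : ℕ) : ℝ) < (i : ℕ) + 1 := by linarith
    have h7 : (i : ℕ) < j + 1 := by exact_mod_cast h5
    have h8 : (j : ℕ) < i + 1 := by exact_mod_cast h6
    exact Fin.ext (by omega)
  have hbij := (Fintype.bijective_iff_injective_and_card c).2 ⟨hinj, by simp⟩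
  obtain ⟨j, hj⟩ := hbij.2 a
  have := hc1 j
  rw [hj] at this
  have h0 : (0:ℝ) ≤ ((j : ℕ) : ℝ) := Nat.cast_nonneg _
  linarith

/-- Coordinates in `[0, L)`. -/
def boxSet (α : Type*) (L : ℝ) : Set (α → ℝ) := {x | ∀ a, x a ∈ Ico (0:ℝ) L}

lemma measurableSet_boxSet (α : Type*) [Fintype α] (L : ℝ) : MeasurableSet (boxSet α L) := by
  have : boxSet α L = ⋂ a, (fun x : α → ℝ => x a) ⁻¹' Ico (0:ℝ) L := by
    ext; simp [boxSet]
  rw [this]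
  exact MeasurableSet.iInter fun a => measurable_pi_apply a measurableSet_Ico

lemma volume_boxSet_ne_top (α : Type*) [Fintype α] (L : ℝ) : volume (boxSet α L) ≠ ⊤ := by
  have : boxSet α L = univ.pi fun _ => Ico (0:ℝ) L := by
    ext; simp [boxSet]
  rw [this, volume_pi_pi]
  exact ENNReal.prod_ne_top fun a _ => by simp

lemma block {α : Type*} [Fintype α] [Nonempty α] (r : α → α → Prop) (N : ℝ)
    (hN : ∀ x ∈ repSet r, mxc x - mnc x ≤ N) :
    ∃ d : ℝ, ∀ (F : ℝ → ENNReal) (_ : Monotone F) (_ : ∀ t, F t ≠ ⊤)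
      (p : Polynomial ℝ) (k : ℕ) (_ : p.natDegree ≤ k) (T : ℝ)
      (_ : ∀ t ≥ T, (F t).toReal = p.eval t),
      ∃ q : Polynomial ℝ, q.natDegree ≤ k + 1 ∧
      q.coeff (k + 1) = d * (p.coeff k / (k + 1)) ∧ ∃ T' : ℝ, ∀ L ≥ T',
      (∫⁻ x in repSet r ∩ boxSet α L, F (mnc x - 1)).toReal = q.eval L := by
  have hR := measurableSet_repSet r
  have hW : MeasurableSet {x : α → ℝ | mnc x ∈ Ico (0:ℝ) 1} := measurable_mnc measurableSet_Ico
  set W : Set (α → ℝ) := repSet r ∩ {x | mnc x ∈ Ico (0:ℝ) 1} with hWdef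
  have hWsub : W ⊆ boxSet α (N + 2) := by
    intro x hx a
    have h1 := hN x hx.1
    have h2 : mnc x ∈ Ico (0:ℝ) 1 := hx.2
    have h3 := mnc_le x a
    have h4 := le_mxc x a
    exact ⟨h2.1.trans h3, by linarith [h2.2]⟩
  have hWfin : volume W ≠ ⊤ := ne_top_of_le_ne_top (volume_boxSet_ne_top α _) (measure_mono hWsub)
  have : IsFiniteMeasure (volume.restrict W) := ⟨by simpa using hWfin.lt_top⟩
  refine ⟨(volume.restrict W).real univ, ?_⟩
  intro F hF hfin p k hp T hFp
  obtain ⟨q, hq1, hq2, T', hq3⟩ := step_poly (volume.restrict W) (fun x => mxc x - mnc x)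
    (measurable_mxc.sub measurable_mnc) N
    (by
      filter_upwards [ae_restrict_mem (hR.inter hW)] with x hx
      exact ⟨sub_nonneg.2 (mnc_le_mxc x), hN x hx.1⟩) F hF hfin p k hp T hFp
  refine ⟨q, hq1, hq2, T', fun L hL => ?_⟩
  rw [← hq3 L hL]
  congr 1
  have hFm : Measurable F := hF.measurable
  have hgm : Measurable fun x : α → ℝ => F (mnc x - 1) := hFm.comp (measurable_mnc.sub_const 1)
  rw [inter_comm, ← Measure.restrict_restrict (measurableSet_boxSet α L),
    ← lintegral_indicator (measurableSet_boxSet α L), disint r _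
      (hgm.indicator (measurableSet_boxSet α L))]
  refine lintegral_congr fun x => ?_
  have h1 : ∀ u : ℝ, (boxSet α L).indicator (fun x => F (mnc x - 1)) (x + fun _ => u) =
      (Ico (0:ℝ) (L - (mxc x - mnc x))).indicator (fun v => F (v - 1)) (u + mnc x) := by
    intro u
    have hiff : (x + fun _ => u) ∈ boxSet α L ↔ u + mnc x ∈ Ico (0:ℝ) (L - (mxc x - mnc x)) := by
      have : (x + fun _ => u) ∈ boxSet α L ↔
          0 ≤ mnc (x + fun _ => u) ∧ mxc (x + fun _ => u) < L := by
        rw [le_mnc_iff, mxc_lt_iff, ← forall_and]; rfl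
      rw [this, mnc_add, mxc_add, mem_Ico]
      constructor <;> rintro ⟨h1, h2⟩ <;> constructor <;> linarith
    by_cases h : u + mnc x ∈ Ico (0:ℝ) (L - (mxc x - mnc x))
    · rw [indicator_of_mem h, indicator_of_mem (hiff.2 h), mnc_add, add_comm u]
    · rw [indicator_of_notMem h, indicator_of_notMem (fun h' => h (hiff.1 h'))]
  simp_rw [h1]
  rw [lintegral_add_right_eq_self
    (fun v => (Ico (0:ℝ) (L - (mxc x - mnc x))).indicator (fun v => F (v - 1)) v) (mnc x),
    lintegral_indicator measurableSet_Ico]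

/-- Region for a chain of blocks. -/
def chainSet {k : ℕ} {P : Fin k → Type} (r : ∀ i, P i → P i → Prop) (L : ℝ) :
    Set (∀ i, P i → ℝ) :=
  {x | (∀ i, x i ∈ repSet (r i)) ∧ (∀ i, x i ∈ boxSet (P i) L) ∧
    ∀ i j, i < j → ∀ a b, x i a + 1 < x j b}

lemma measurableSet_chainSet {k : ℕ} {P : Fin k → Type} [∀ i, Fintype (P i)]
    (r : ∀ i, P i → P i → Prop) (L : ℝ) : MeasurableSet (chainSet r L) := by
  have : chainSet r L = (⋂ i, (fun x : ∀ i, P i → ℝ => x i) ⁻¹' repSet (r i)) ∩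
      ((⋂ i, (fun x : ∀ i, P i → ℝ => x i) ⁻¹' boxSet (P i) L) ∩
      ⋂ i, ⋂ j, ⋂ (_ : i < j), ⋂ a, ⋂ b, {x : ∀ i, P i → ℝ | x i a + 1 < x j b}) := by
    ext; simp [chainSet]
  rw [this]
  refine (MeasurableSet.iInter fun i => measurable_pi_apply i (measurableSet_repSet _)).inter
    ((MeasurableSet.iInter fun i => measurable_pi_apply i (measurableSet_boxSet _ _)).inter ?_)
  refine MeasurableSet.iInter fun i => MeasurableSet.iInter fun j => MeasurableSet.iInter fun _ =>
    MeasurableSet.iInter fun a => MeasurableSet.iInter fun b => ?_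
  refine measurableSet_lt ?_ ?_
  · exact ((measurable_pi_apply a).comp (measurable_pi_apply i)).add_const 1
  · exact (measurable_pi_apply b).comp (measurable_pi_apply j)

lemma volume_chainSet_ne_top {k : ℕ} {P : Fin k → Type} [∀ i, Fintype (P i)]
    (r : ∀ i, P i → P i → Prop) (L : ℝ) : volume (chainSet r L) ≠ ⊤ := by
  have : chainSet r L ⊆ univ.pi fun i => boxSet (P i) L := fun x hx i _ => hx.2.1 i
  refine ne_top_of_le_ne_top ?_ (measure_mono this)
  rw [volume_pi_pi]
  exact ENNReal.prod_ne_top fun i _ => volume_boxSet_ne_top _ _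

lemma chainSet_mono {k : ℕ} {P : Fin k → Type} (r : ∀ i, P i → P i → Prop) :
    Monotone (chainSet r) := by
  intro s t hst x hx
  exact ⟨hx.1, fun i a => ⟨(hx.2.1 i a).1, (hx.2.1 i a).2.trans_le hst⟩, hx.2.2⟩

lemma chain_succ {k : ℕ} (P : Fin (k + 1) → Type) [∀ i, Fintype (P i)] [∀ i, Nonempty (P i)]
    (r : ∀ i, P i → P i → Prop) (L : ℝ) :
    volume (chainSet r L) =
      ∫⁻ x in repSet (r (Fin.last k)) ∩ boxSet (P (Fin.last k)) L,
        volume (chainSet (fun j : Fin k => r ((Fin.last k).succAbove j)) (mnc x - 1)) := by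
  have hmp := (volume_preserving_piFinSuccAbove (fun i => P i → ℝ) (Fin.last k)).symm
  rw [← hmp.measure_preimage (measurableSet_chainSet r L).nullMeasurableSet,
    Measure.volume_eq_prod, Measure.prod_apply
      (hmp.measurable (measurableSet_chainSet r L)),
    ← lintegral_indicator ((measurableSet_repSet _).inter (measurableSet_boxSet _ _))]
  refine lintegral_congr fun x => ?_
  have hmem : ∀ y, (x, y) ∈ (MeasurableEquiv.piFinSuccAbove (fun i => P i → ℝ) (Fin.last k)).symm
      ⁻¹' chainSet r L ↔ x ∈ repSet (r (Fin.last k)) ∩ boxSet (P (Fin.last k)) L ∧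
        y ∈ chainSet (fun j : Fin k => r ((Fin.last k).succAbove j)) (mnc x - 1) := by
    intro y
    rw [mem_preimage]
    set z := (MeasurableEquiv.piFinSuccAbove (fun i => P i → ℝ) (Fin.last k)).symm (x, y) with hz
    have hez : (MeasurableEquiv.piFinSuccAbove (fun i => P i → ℝ) (Fin.last k)) z = (x, y) :=
      MeasurableEquiv.apply_symm_apply _ _
    have hz1 : z (Fin.last k) = x := congrArg Prod.fst hez
    have hz2 : ∀ j, z ((Fin.last k).succAbove j) = y j := fun j =>
      congrFun (congrArg Prod.snd hez) j
    have hlt : ∀ j, (Fin.last k).succAbove j < Fin.last k := by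
      intro j; rw [Fin.succAbove_last]; exact Fin.castSucc_lt_last j
    constructor
    · rintro ⟨h1, h2, h3⟩
      refine ⟨⟨hz1 ▸ h1 _, hz1 ▸ h2 _⟩, fun j => hz2 j ▸ h1 _, fun j a => ⟨?_, ?_⟩, ?_⟩
      · rw [← hz2]; exact (h2 _ a).1
      · rw [lt_sub_iff_add_lt, lt_mnc_iff]
        intro b
        rw [← hz2, ← hz1]
        exact h3 _ _ (hlt j) a b
      · intro i j hij a b
        rw [← hz2, ← hz2]
        exact h3 _ _ (Fin.strictMono_succAbove _ hij) a b
    · rintro ⟨⟨g1, g2⟩, h1, h2, h3⟩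
      have hxy : ∀ j a b, y j a + 1 < x b := by
        intro j a b
        exact (lt_mnc_iff x _).1 (lt_sub_iff_add_lt.1 (h2 j a).2) b
      refine ⟨?_, ?_, ?_⟩
      · rw [Fin.forall_iff_succAbove (Fin.last k)]
        exact ⟨by rw [hz1]; exact g1, fun j => by rw [hz2]; exact h1 j⟩
      · rw [Fin.forall_iff_succAbove (Fin.last k)]
        refine ⟨by rw [hz1]; exact g2, fun j a => ?_⟩
        rw [hz2]
        refine ⟨(h2 j a).1, ?_⟩
        obtain ⟨b⟩ := (inferInstance : Nonempty (P (Fin.last k)))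
        have := hxy j a b
        have := (g2 b).2
        linarith
      · rw [Fin.forall_iff_succAbove (Fin.last k)]
        refine ⟨fun j hj => absurd (Fin.le_last j) (not_le.2 hj), fun i => ?_⟩
        rw [Fin.forall_iff_succAbove (Fin.last k)]
        refine ⟨fun _ a b => ?_, fun j hij a b => ?_⟩
        · rw [hz2, hz1]
          exact hxy i a b
        · rw [hz2, hz2]
          exact h3 i j ((Fin.strictMono_succAbove _).lt_iff_lt.1 hij) a b
  by_cases hx : x ∈ repSet (r (Fin.last k)) ∩ boxSet (P (Fin.last k)) L
  · rw [indicator_of_mem hx]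
    congr 1
    ext y
    exact (hmem y).trans (and_iff_right hx)
  · rw [indicator_of_notMem hx]
    convert measure_empty (μ := (volume : Measure (∀ j : Fin k, P ((Fin.last k).succAbove j) → ℝ)))
    ext y
    simp only [mem_empty_iff_false, iff_false]
    exact fun h => hx ((hmem y).1 h).1

lemma chain_poly : ∀ (k : ℕ) (P : Fin k → Type) [∀ i, Fintype (P i)] [∀ i, Nonempty (P i)]
    (r : ∀ i, P i → P i → Prop) (d : Fin k → ℝ)
    (_ : ∀ i, ∀ (F : ℝ → ENNReal) (_ : Monotone F) (_ : ∀ t, F t ≠ ⊤)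
      (p : Polynomial ℝ) (k : ℕ) (_ : p.natDegree ≤ k) (T : ℝ)
      (_ : ∀ t ≥ T, (F t).toReal = p.eval t),
      ∃ q : Polynomial ℝ, q.natDegree ≤ k + 1 ∧
      q.coeff (k + 1) = d i * (p.coeff k / (k + 1)) ∧ ∃ T' : ℝ, ∀ L ≥ T',
      (∫⁻ x in repSet (r i) ∩ boxSet (P i) L, F (mnc x - 1)).toReal = q.eval L),
    ∃ q : Polynomial ℝ, q.natDegree ≤ k ∧ q.coeff k = (∏ i, d i) / (Nat.factorial k : ℝ) ∧
      ∃ T : ℝ, ∀ L ≥ T, (volume (chainSet r L)).toReal = q.eval L := by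
  intro k
  induction k with
  | zero =>
    intro P _ _ r d _
    refine ⟨1, by simp, by simp, 0, fun L _ => ?_⟩
    have : chainSet r L = univ.pi fun _ => univ := by
      ext x; simp [chainSet]
    rw [this, volume_pi_pi]
    simp
  | succ k ih =>
    intro P _ _ r d h
    obtain ⟨p, hp1, hp2, T, hp3⟩ := ih (fun j => P ((Fin.last k).succAbove j))
      (fun j => r ((Fin.last k).succAbove j)) (fun j => d ((Fin.last k).succAbove j))
      (fun j => h _)
    obtain ⟨q, hq1, hq2, T', hq3⟩ := h (Fin.last k)
      (fun t => volume (chainSet (fun j : Fin k => r ((Fin.last k).succAbove j)) t))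
      (fun s t hst => measure_mono (chainSet_mono _ hst))
      (fun t => volume_chainSet_ne_top _ _) p k hp1 T hp3
    refine ⟨q, hq1, ?_, T', fun L hL => ?_⟩
    · rw [hq2, hp2, Fin.prod_univ_succAbove _ (Fin.last k), Nat.factorial_succ]
      push_cast
      field_simp
    · rw [chain_succ]; exact hq3 L hL

/-- Automorphisms of a relation. -/
def AutRel {α : Type*} (r : α → α → Prop) : Type _ :=
  {σ : Equiv.Perm α // ∀ a b, r a b ↔ r (σ a) (σ b)}

instance {α : Type*} [Finite α] (r : α → α → Prop) : Finite (AutRel r) :=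
  inferInstanceAs (Finite {σ : Equiv.Perm α // ∀ a b, r a b ↔ r (σ a) (σ b)})

instance {α : Type*} (r : α → α → Prop) : Nonempty (AutRel r) :=
  ⟨⟨Equiv.refl _, fun _ _ => Iff.rfl⟩⟩

lemma measurePreserving_comp {α β : Type*} [Fintype α] [Fintype β] (e : α ≃ β) :
    MeasurePreserving (fun (x : β → ℝ) (a : α) => x (e a)) :=
  (volume_measurePreserving_piCongrLeft (fun _ : β => ℝ) e).symm

lemma genVol_mul {α : Type*} [Fintype α] (r : α → α → Prop) (L : ℝ) :
    (Nat.card (AutRel r) : ℝ) * genVol r L =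
      (Nat.factorial (Fintype.card α) : ℝ) * (volume (repSet r ∩ boxSet α L)).toReal := by
  classical
  set V : Set (α → ℝ) := {x | ∃ e : α ≃ α, ∀ a b : α, r a b ↔ x (e a) + 1 < x (e b)} with hV
  have h1 : genVol r L = (volume (boxSet α L ∩ V)).toReal := by
    unfold genVol
    congr 1
    have hae : (boxSet α L : Set (α → ℝ)) =ᵐ[volume] {x : α → ℝ | ∀ i, x i ∈ Icc (0:ℝ) L} := by
      have := Measure.univ_pi_Ico_ae_eq_Icc (μ := fun _ : α => (volume : Measure ℝ))
        (f := fun _ => 0) (g := fun _ => L)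
      have e1 : boxSet α L = univ.pi fun _ => Ico (0:ℝ) L := by ext; simp [boxSet]
      have e2 : {x : α → ℝ | ∀ i, x i ∈ Icc (0:ℝ) L} = Icc (fun _ => 0) (fun _ => L) := by
        ext x; simp [Pi.le_def, forall_and]
      rw [e1, e2]
      exact this
    exact measure_congr ((hae.symm.inter (ae_eq_refl V)))
  set A : Equiv.Perm α → Set (α → ℝ) := fun e =>
    (fun (x : α → ℝ) (a : α) => x (e a)) ⁻¹' (repSet r ∩ boxSet α L) with hA
  have hRB : MeasurableSet (repSet r ∩ boxSet α L) :=
    (measurableSet_repSet r).inter (measurableSet_boxSet α L)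
  have hAm : ∀ e, MeasurableSet (A e) := fun e => (measurePreserving_comp e).measurable hRB
  have hAv : ∀ e, volume (A e) = volume (repSet r ∩ boxSet α L) := fun e =>
    (measurePreserving_comp e).measure_preimage hRB.nullMeasurableSet
  have hmem : ∀ e x, x ∈ A e ↔ (∀ a b, r a b ↔ x (e a) + 1 < x (e b)) ∧ x ∈ boxSet α L := by
    intro e x
    refine and_congr Iff.rfl ?_
    constructor
    · intro h a
      have := h (e.symm a)
      simpa using this
    · intro h a
      exact h (e a)
  have hVA : boxSet α L ∩ V = ⋃ e, A e := by
    ext x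
    simp only [mem_iUnion, hmem, hV, mem_inter_iff, mem_ofPred_eq]
    constructor
    · rintro ⟨h, e, he⟩; exact ⟨e, he, h⟩
    · rintro ⟨e, he, h⟩; exact ⟨h, e, he⟩
  have hVm : MeasurableSet (boxSet α L ∩ V) := by
    rw [hVA]; exact MeasurableSet.iUnion hAm
  have hcount : ∀ x, ∑ e, (A e).indicator (1 : (α → ℝ) → ENNReal) x =
      (Nat.card (AutRel r) : ENNReal) * (boxSet α L ∩ V).indicator 1 x := by
    intro x
    by_cases hx : x ∈ boxSet α L ∩ V
    · rw [indicator_of_mem hx, Pi.one_apply, mul_one]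
      obtain ⟨hxb, e₀, he₀⟩ := hx
      have : Nat.card (AutRel r) = Nat.card {e : Equiv.Perm α // x ∈ A e} := by
        refine Nat.card_congr (Equiv.subtypeEquiv (Equiv.mulLeft e₀) fun σ => ?_)
        rw [hmem, and_iff_left hxb]
        refine forall_congr' fun a => forall_congr' fun b => ?_
        rw [he₀ (σ a) (σ b)]
        rfl
      rw [this, Nat.card_eq_fintype_card, Fintype.card_subtype]
      simp [indicator]
    · rw [indicator_of_notMem hx, mul_zero]
      refine Finset.sum_eq_zero fun e _ => indicator_of_notMem (fun h => hx ?_) _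
      rw [hVA]; exact mem_iUnion.2 ⟨e, h⟩
  have hint : ∑ e, volume (A e) = (Nat.card (AutRel r) : ENNReal) * volume (boxSet α L ∩ V) := by
    rw [← lintegral_indicator_one hVm, ← lintegral_const_mul _ (measurable_one.indicator hVm)]
    simp_rw [← hcount]
    rw [lintegral_finsetSum _ fun e _ => measurable_one.indicator (hAm e)]
    refine Finset.sum_congr rfl fun e _ => ?_
    rw [lintegral_indicator_one (hAm e)]
  simp only [hAv, Finset.sum_const, Finset.card_univ, Fintype.card_perm, nsmul_eq_mul] at hint
  have := congrArg ENNReal.toReal hint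
  rw [ENNReal.toReal_mul, ENNReal.toReal_mul, ENNReal.toReal_natCast, ENNReal.toReal_natCast] at this
  rw [h1, this]

lemma lex_lt_of_fst {k : ℕ} {P : Fin k → Type} [∀ i, PartialOrder (P i)]
    {x y : Σₗ i, P i} (h : (ofLex x).1 < (ofLex y).1) : x < y :=
  Sigma.Lex.lt_def.2 (Or.inl h)

lemma lex_mk_lt {k : ℕ} {P : Fin k → Type} [∀ i, PartialOrder (P i)] (i : Fin k) (a b : P i) :
    (toLex (⟨i, a⟩ : Σ i, P i) : Σₗ i, P i) < toLex ⟨i, b⟩ ↔ a < b := by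
  rw [Sigma.Lex.lt_def]
  constructor
  · rintro (h | ⟨h, h'⟩)
    · exact absurd h (lt_irrefl i)
    · exact h'
  · intro h
    exact Or.inr ⟨rfl, h⟩

lemma aut_fst {k : ℕ} {P : Fin k → Type} [∀ i, Fintype (P i)] [∀ i, PartialOrder (P i)]
    (σ : AutRel (fun a b : Σₗ i, P i => a < b)) (x : Σₗ i, P i) :
    (ofLex (σ.1 x)).1 = (ofLex x).1 := by
  have key : ∀ (j : Fin k) (a : Σₗ i, P i), (ofLex a).1 ≤ j → (ofLex (σ.1 a)).1 ≤ j := by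
    intro j a ha
    by_contra hcon
    push Not at hcon
    have hmaps : ∀ b : Σₗ i, P i, j < (ofLex b).1 → j < (ofLex (σ.1 b)).1 := by
      intro b hb
      by_contra hb2
      push Not at hb2
      have h1 : a < b := lex_lt_of_fst (ha.trans_lt hb)
      have h2 : σ.1 a < σ.1 b := (σ.2 a b).1 h1
      exact lt_asymm h2 (lex_lt_of_fst (hb2.trans_lt hcon))
    have hf : Function.Surjective (fun b : {b : Σₗ i, P i // j < (ofLex b).1} =>
        (⟨σ.1 b.1, hmaps _ b.2⟩ : {b : Σₗ i, P i // j < (ofLex b).1})) := by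
      refine Finite.surjective_of_injective fun b c hbc => ?_
      exact Subtype.ext (σ.1.injective (congrArg Subtype.val hbc))
    obtain ⟨b, hb⟩ := hf ⟨σ.1 a, hcon⟩
    have := σ.1.injective (congrArg Subtype.val hb)
    exact absurd (this ▸ b.2) (not_lt.2 ha)
  have key2 : ∀ (j : Fin k) (a : Σₗ i, P i), (ofLex (σ.1 a)).1 ≤ j → (ofLex a).1 ≤ j := by
    intro j a ha
    have hf : Function.Surjective (fun b : {b : Σₗ i, P i // (ofLex b).1 ≤ j} =>
        (⟨σ.1 b.1, key j _ b.2⟩ : {b : Σₗ i, P i // (ofLex b).1 ≤ j})) := by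
      refine Finite.surjective_of_injective fun b c hbc => ?_
      exact Subtype.ext (σ.1.injective (congrArg Subtype.val hbc))
    obtain ⟨b, hb⟩ := hf ⟨σ.1 a, ha⟩
    have := σ.1.injective (congrArg Subtype.val hb)
    exact this ▸ b.2
  exact le_antisymm (key _ _ le_rfl) (key2 _ _ le_rfl)

lemma card_aut_lex {k : ℕ} {P : Fin k → Type} [∀ i, Fintype (P i)] [∀ i, PartialOrder (P i)] :
    Nat.card (AutRel (fun a b : Σₗ i, P i => a < b)) =
      ∏ i, Nat.card (AutRel (fun a b : P i => a < b)) := by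
  rw [← Nat.card_pi]
  symm
  have hsame : ∀ (i : Fin k) (a b : P i) (τ : ∀ i, AutRel (fun a b : P i => a < b)),
    ((τ i).1 a < (τ i).1 b ↔ a < b) := fun i a b τ => ((τ i).2 a b).symm
  let f : (∀ i, AutRel (fun a b : P i => a < b)) → AutRel (fun a b : Σₗ i, P i => a < b) :=
    fun τ => ⟨(ofLex.trans (Equiv.sigmaCongrRight fun i => (τ i).1)).trans toLex, by
      rintro ⟨i, a⟩ ⟨j, b⟩
      show (toLex (⟨i, a⟩ : Σ i, P i) : Σₗ i, P i) < toLex ⟨j, b⟩ ↔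
        (toLex (⟨i, (τ i).1 a⟩ : Σ i, P i) : Σₗ i, P i) < toLex ⟨j, (τ j).1 b⟩
      rcases lt_trichotomy i j with h | h | h
      · exact iff_of_true (lex_lt_of_fst h) (lex_lt_of_fst h)
      · subst h
        rw [lex_mk_lt, lex_mk_lt, hsame]
      · exact iff_of_false (lt_asymm (lex_lt_of_fst h)) (lt_asymm (lex_lt_of_fst h))⟩
  have hf : ∀ τ i a, (f τ).1 (toLex ⟨i, a⟩) = toLex ⟨i, (τ i).1 a⟩ := fun _ _ _ => rfl
  refine Nat.card_congr (Equiv.ofBijective f ⟨?_, ?_⟩)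
  · intro τ τ' h
    funext i
    refine Subtype.ext (Equiv.ext fun a => ?_)
    have h1 := hf τ i a
    rw [h, hf] at h1
    have h2 := toLex.injective h1
    simpa using h2.symm
  · intro σ
    have hex : ∀ i (a : P i), ∃ b : P i, σ.1 (toLex ⟨i, a⟩) = toLex ⟨i, b⟩ := by
      intro i a
      have h := aut_fst σ (toLex ⟨i, a⟩)
      obtain ⟨⟨j, b⟩, hjb⟩ : ∃ z : Σ i, P i, σ.1 (toLex ⟨i, a⟩) = toLex z := ⟨ofLex _, rfl⟩
      rw [hjb] at h
      have h' : j = i := h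
      subst h'
      exact ⟨b, hjb⟩
    choose g hg using hex
    have hinj : ∀ i, Function.Injective (g i) := by
      intro i a b hab
      have h1 := hg i a
      rw [hab, ← hg i b] at h1
      have := toLex.injective (σ.1.injective h1)
      simpa using this
    refine ⟨fun i => ⟨Equiv.ofBijective (g i) (Finite.injective_iff_bijective.1 (hinj i)), ?_⟩, ?_⟩
    · intro a b
      show a < b ↔ g i a < g i b
      rw [← lex_mk_lt, ← lex_mk_lt i (g i a), ← hg, ← hg]
      exact σ.2 _ _
    · refine Subtype.ext (Equiv.ext ?_)
      rintro ⟨i, a⟩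
      exact (hg i a).symm

lemma measurePreserving_uncurry {k : ℕ} {P : Fin k → Type} [∀ i, Fintype (P i)] :
    MeasurePreserving (fun (x : ∀ i, P i → ℝ) (s : Σ i, P i) => x s.1 s.2) := by
  have hm : Measurable (fun (x : ∀ i, P i → ℝ) (s : Σ i, P i) => x s.1 s.2) :=
    measurable_pi_lambda _ fun s => (measurable_pi_apply s.2).comp (measurable_pi_apply s.1)
  refine ⟨hm, ?_⟩
  symm
  refine Measure.pi_eq fun s hs => ?_
  rw [Measure.map_apply hm (MeasurableSet.univ_pi hs)]
  have : (fun (x : ∀ i, P i → ℝ) (s : Σ i, P i) => x s.1 s.2) ⁻¹' univ.pi s =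
      univ.pi fun i => univ.pi fun a => s ⟨i, a⟩ := by
    ext x
    simp [Sigma.forall]
  rw [this, volume_pi_pi]
  simp_rw [volume_pi_pi]
  rw [Fintype.prod_sigma]

lemma volume_lex {k : ℕ} {P : Fin k → Type} [∀ i, Fintype (P i)] [∀ i, PartialOrder (P i)]
    (hne : ∀ i, Nonempty (P i)) (L : ℝ) :
    volume (repSet (fun a b : Σₗ i, P i => a < b) ∩ boxSet (Σₗ i, P i) L) =
      volume (chainSet (fun i (a b : P i) => a < b) L) := by
  have hmp : MeasurePreserving (fun (x : ∀ i, P i → ℝ) (s : Σₗ i, P i) =>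
      x (ofLex s).1 (ofLex s).2) :=
    (measurePreserving_comp (ofLex : (Σₗ i, P i) ≃ (Σ i, P i))).comp measurePreserving_uncurry
  rw [← hmp.measure_preimage ((measurableSet_repSet _).inter
    (measurableSet_boxSet _ L)).nullMeasurableSet]
  congr 1
  ext x
  constructor
  · rintro ⟨h1, h2⟩
    refine ⟨fun i a b => ?_, fun i a => h2 (toLex ⟨i, a⟩), fun i j hij a b => ?_⟩
    · exact (lex_mk_lt i a b).symm.trans (h1 (toLex ⟨i, a⟩) (toLex ⟨i, b⟩))
    · exact (h1 (toLex ⟨i, a⟩) (toLex ⟨j, b⟩)).1 (lex_lt_of_fst hij)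
  · rintro ⟨h1, h2, h3⟩
    refine ⟨?_, fun s => h2 _ _⟩
    rintro ⟨i, a⟩ ⟨j, b⟩
    show (toLex (⟨i, a⟩ : Σ i, P i) : Σₗ i, P i) < toLex ⟨j, b⟩ ↔ x i a + 1 < x j b
    rcases lt_trichotomy i j with h | h | h
    · exact iff_of_true (lex_lt_of_fst h) (h3 _ _ h _ _)
    · subst h
      rw [lex_mk_lt]; exact h1 _ _ _
    · refine iff_of_false (lt_asymm (lex_lt_of_fst h)) ?_
      have := h3 _ _ h b a
      linarith

/-- Theorem on lexicographic sums of bricks over a chain: the volume is a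
multinomial-coefficient multiple of `c₁⋯c_k/k! · L^k` plus a lower-degree error. -/
theorem lex_sum_of_bricks_volume (k : ℕ) (hk : 1 ≤ k)
    (P : Fin k → Type) [∀ i, Fintype (P i)] [∀ i, PartialOrder (P i)]
    (hsem : ∀ i, IsSemiorder (P i)) (hbrick : ∀ i, IsBrick (P i))
    (c : Fin k → ℝ) (hc : ∀ i, 0 < c i)
    (hlim : ∀ i, Tendsto (fun L : ℝ => genVol (fun a b : P i => a < b) L / L)
      atTop (nhds (c i))) :
    ∃ E : Polynomial ℝ, E.degree < (k : ℕ) ∧ ∃ L₀ : ℝ, ∀ L ≥ L₀,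
      genVol (fun a b : Σₗ i, P i => a < b) L =
        ((Nat.factorial (∑ i, Fintype.card (P i)) : ℝ) /
            ∏ i, (Nat.factorial (Fintype.card (P i)) : ℝ)) *
          ((∏ i, c i) / (Nat.factorial k : ℝ)) * L ^ k + E.eval L := by
  have hne : ∀ i, Nonempty (P i) := by
    intro i
    by_contra hemp
    rw [not_nonempty_iff] at hemp
    have h1 : ∀ L : ℝ, genVol (fun a b : P i => a < b) L = 1 := by
      intro L
      unfold genVol
      have : {x : P i → ℝ | (∀ i, x i ∈ Icc (0:ℝ) L) ∧
        ∃ e : P i ≃ P i, ∀ a b : P i, a < b ↔ x (e a) + 1 < x (e b)} =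
          univ.pi fun _ => univ := by
        ext x; simp
      rw [this, volume_pi_pi]
      simp
    have h2 := hlim i
    simp_rw [h1, one_div] at h2
    exact (hc i).ne (tendsto_nhds_unique tendsto_inv_atTop_zero h2)
  have hb := fun i => block (fun a b : P i => a < b) (Fintype.card (P i))
    (brick_spread (hbrick i))
  choose d hd using hb
  have haut : ∀ i, (Nat.card (AutRel (fun a b : P i => a < b)) : ℝ) ≠ 0 := fun i =>
    Nat.cast_ne_zero.2 Nat.card_pos.ne'
  have hcd : ∀ i, d i = Nat.card (AutRel (fun a b : P i => a < b)) * c i /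
      Nat.factorial (Fintype.card (P i)) := by
    intro i
    obtain ⟨q, hq1, hq2, T, hq3⟩ := hd i (fun _ => 1) monotone_const (fun _ => by simp) 1 0
      (by simp) 0 (by simp)
    simp only [lintegral_const, one_mul, Measure.restrict_apply_univ] at hq3
    have hfac : (Nat.factorial (Fintype.card (P i)) : ℝ) ≠ 0 :=
      Nat.cast_ne_zero.2 (Nat.factorial_ne_zero _)
    rw [eq_div_iff hfac, mul_comm (d i)]
    have hq2' : q.coeff 1 = d i := by simpa using hq2
    have t1 : Tendsto (fun L : ℝ => (Nat.card (AutRel (fun a b : P i => a < b)) : ℝ) *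
        (genVol (fun a b : P i => a < b) L / L)) atTop
        (nhds (Nat.card (AutRel (fun a b : P i => a < b)) * c i)) := (hlim i).const_mul _
    have t2 : Tendsto (fun L : ℝ => (Nat.factorial (Fintype.card (P i)) : ℝ) *
        (d i + q.coeff 0 * L⁻¹)) atTop
        (nhds ((Nat.factorial (Fintype.card (P i)) : ℝ) * (d i + q.coeff 0 * 0))) :=
      ((tendsto_inv_atTop_zero.const_mul _).const_add _).const_mul _
    rw [mul_zero, add_zero] at t2
    refine tendsto_nhds_unique (t2.congr' ?_) t1
    filter_upwards [eventually_ge_atTop T, eventually_gt_atTop 0] with L hL hL0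
    rw [← mul_div_assoc, genVol_mul, hq3 L hL,
      Polynomial.eval_eq_sum_range' (n := 2) (by omega)]
    simp only [Finset.sum_range_succ, Finset.sum_range_zero, hq2']
    field_simp
    ring
  obtain ⟨p, hp1, hp2, T, hp3⟩ := chain_poly k P (fun i (a b : P i) => a < b) d hd
  set A : ℝ := ∏ i, (Nat.card (AutRel (fun a b : P i => a < b)) : ℝ) with hA
  have hA0 : A ≠ 0 := Finset.prod_ne_zero_iff.2 fun i _ => haut i
  set M : ℝ := (Nat.factorial (∑ i, Fintype.card (P i)) : ℝ) with hM
  set q : Polynomial ℝ := Polynomial.C (M / A) * p with hq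
  have hqc : q.coeff k = (M / ∏ i, (Nat.factorial (Fintype.card (P i)) : ℝ)) *
      ((∏ i, c i) / (Nat.factorial k : ℝ)) := by
    rw [hq, Polynomial.coeff_C_mul, hp2]
    simp_rw [hcd]
    rw [Finset.prod_div_distrib, Finset.prod_mul_distrib, ← hA]
    field_simp
  refine ⟨q - Polynomial.C (q.coeff k) * Polynomial.X ^ k, ?_, T, ?_⟩
  · rw [Polynomial.degree_lt_iff_coeff_zero]
    intro m hm
    rw [Polynomial.coeff_sub, Polynomial.coeff_C_mul_X_pow]
    rcases hm.eq_or_lt with h | h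
    · subst h; simp
    · rw [if_neg (by omega), sub_zero, hq, Polynomial.coeff_C_mul,
        Polynomial.coeff_eq_zero_of_natDegree_lt (by omega), mul_zero]
  · intro L hL
    rw [← hqc]
    simp only [Polynomial.eval_sub, Polynomial.eval_mul, Polynomial.eval_C, Polynomial.eval_pow,
      Polynomial.eval_X]
    have h := genVol_mul (fun a b : Σₗ i, P i => a < b) L
    have hcard : Fintype.card (Σₗ i, P i) = ∑ i, Fintype.card (P i) := by
      rw [← Fintype.card_sigma]
      exact Fintype.card_congr ofLex
    rw [volume_lex hne, hp3 L hL, card_aut_lex, hcard, Nat.cast_prod, ← hA, ← hM] at h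
    have h' : genVol (fun a b : Σₗ i, P i => a < b) L = q.eval L := by
      rw [hq, Polynomial.eval_mul, Polynomial.eval_C]
      field_simp
      linarith
    rw [h']
    ring
end

section
/- Let P₁, …, P_k be finite semiorders that are bricks, with |P_i| = n_i and n = n₁ + ⋯ + n_k, and let P be their lexicographic sum over the k-chain. For each i, let c_i > 0 be the constant with lim_{L→∞} V_{P_i}(L)/L = c_i. Then lim_{L→∞} V_P(L)/L^k = (n! / (n₁!·n₂!·⋯·n_k!)) · (c₁ c₂ ⋯ c_k / k!). -/
open MeasureTheory Set Filter

namespace LexVol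

/-- Tuples realizing the poset up to relabelling. -/
def RS (α : Type*) [Preorder α] : Set (α → ℝ) :=
  {x | ∃ e : α ≃ α, ∀ a b : α, a < b ↔ x (e a) + 1 < x (e b)}

theorem measurableSet_rel {α : Type*} [Fintype α] (r : α → α → Prop) :
    MeasurableSet {x : α → ℝ | ∃ e : α ≃ α, ∀ a b : α, r a b ↔ x (e a) + 1 < x (e b)} := by
  classical
  have : {x : α → ℝ | ∃ e : α ≃ α, ∀ a b : α, r a b ↔ x (e a) + 1 < x (e b)}
      = ⋃ e : α ≃ α, ⋂ a : α, ⋂ b : α, {x : α → ℝ | r a b ↔ x (e a) + 1 < x (e b)} := by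
    ext x; simp
  rw [this]
  refine MeasurableSet.iUnion fun e => MeasurableSet.iInter fun a => MeasurableSet.iInter fun b => ?_
  have h : MeasurableSet {x : α → ℝ | x (e a) + 1 < x (e b)} :=
    measurableSet_lt (by fun_prop) (by fun_prop)
  by_cases hr : r a b
  · simpa [hr] using h
  · simp only [hr, false_iff]
    exact h.compl

theorem measurableSet_RS (α : Type*) [Fintype α] [Preorder α] : MeasurableSet (RS α) :=
  measurableSet_rel _

theorem measurableSet_box {α : Type*} [Fintype α] (L : ℝ) :
    MeasurableSet {x : α → ℝ | ∀ i, x i ∈ Icc (0:ℝ) L} := by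
  have : {x : α → ℝ | ∀ i, x i ∈ Icc (0:ℝ) L} = univ.pi fun _ => Icc (0:ℝ) L := by
    ext x; simp only [Set.mem_pi, Set.mem_univ, true_imp_iff, Set.mem_ofPred_eq]
  rw [this]
  exact MeasurableSet.univ_pi fun _ => measurableSet_Icc

theorem volume_comp_perm {α : Type*} [Fintype α] (e : Equiv.Perm α) (A : Set (α → ℝ))
    (hA : MeasurableSet A) :
    volume {x : α → ℝ | x ∘ e ∈ A} = volume A := by
  have h := measurePreserving_arrowCongr' (μ := fun _ : α => (volume : Measure ℝ))
    (ν := fun _ : α => (volume : Measure ℝ)) e.symm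
    (MeasurableEquiv.refl ℝ) (fun _ => MeasurePreserving.id _)
  have h2 := h.measure_preimage hA.nullMeasurableSet
  exact h2

open Classical in
theorem perm_sum {α : Type*} [Fintype α] (A S : Set (α → ℝ)) (hA : MeasurableSet A)
    (hS : MeasurableSet S) (N : ℕ)
    (h : ∀ᵐ x : α → ℝ, (Finset.univ.filter fun e : Equiv.Perm α => x ∘ e ∈ A).card
      = if x ∈ S then N else 0) :
    (Nat.factorial (Fintype.card α) : ENNReal) * volume A = N * volume S := by
  have hm : ∀ e : Equiv.Perm α, MeasurableSet {x : α → ℝ | x ∘ e ∈ A} := by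
    intro e
    have : Measurable fun x : α → ℝ => x ∘ e := by
      refine measurable_pi_lambda _ fun a => measurable_pi_apply _
    exact this hA
  have h1 : ∑ e : Equiv.Perm α, volume {x : α → ℝ | x ∘ e ∈ A}
      = (Nat.factorial (Fintype.card α) : ENNReal) * volume A := by
    simp [volume_comp_perm _ A hA, Fintype.card_perm]
  rw [← h1]
  have h2 : ∀ e : Equiv.Perm α, volume {x : α → ℝ | x ∘ e ∈ A}
      = ∫⁻ x, ({x : α → ℝ | x ∘ e ∈ A}).indicator 1 x := fun e =>
    (lintegral_indicator_one (hm e)).symm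
  simp_rw [h2]
  rw [← lintegral_finsetSum _ fun e _ => (measurable_one.indicator (hm e)),
    ← lintegral_indicator_one hS, ← lintegral_const_mul _ (measurable_one.indicator hS)]
  refine lintegral_congr_ae ?_
  filter_upwards [h] with x hx
  have : (∑ e : Equiv.Perm α, ({x : α → ℝ | x ∘ e ∈ A}).indicator (1 : (α → ℝ) → ENNReal) x)
      = ((Finset.univ.filter fun e : Equiv.Perm α => x ∘ e ∈ A).card : ENNReal) := by
    simp [Set.indicator_apply]
  rw [this, hx]
  by_cases hxS : x ∈ S <;> simp [hxS]

theorem ae_injective (k : ℕ) : ∀ᵐ t : Fin k → ℝ, Function.Injective t := by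
  have h : ∀ i j : Fin k, i ≠ j → ∀ᵐ t : Fin k → ℝ, t i ≠ t j := by
    intro i j hij
    let s : Submodule ℝ (Fin k → ℝ) :=
      LinearMap.ker (LinearMap.proj (R := ℝ) (φ := fun _ : Fin k => ℝ) i - LinearMap.proj j)
    have hs : s ≠ ⊤ := by
      intro hs
      have : Pi.single i (1:ℝ) ∈ s := by rw [hs]; trivial
      simp [s, hij.symm] at this
    have := Measure.addHaar_submodule (volume : Measure (Fin k → ℝ)) s hs
    rw [ae_iff]
    convert this using 2
    ext t
    simp [s, sub_eq_zero]
  have h' : ∀ᵐ t : Fin k → ℝ, ∀ i j : Fin k, i ≠ j → t i ≠ t j := by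
    rw [ae_all_iff]; intro i; rw [ae_all_iff]; intro j
    by_cases hij : i = j
    · simp [hij]
    · filter_upwards [h i j hij] with t ht _ using ht
  filter_upwards [h'] with t ht i j hij
  by_contra hne
  exact ht i j hne hij

/-- The ordered simplex. -/
def ordSimplex (k : ℕ) (L : ℝ) : Set (Fin k → ℝ) := {t | (∀ i, t i ∈ Icc (0:ℝ) L) ∧ StrictMono t}

theorem measurableSet_ordSimplex (k : ℕ) (L : ℝ) : MeasurableSet (ordSimplex k L) := by
  refine (measurableSet_box L).inter ?_
  have : {t : Fin k → ℝ | StrictMono t} = ⋂ i : Fin k, ⋂ j : Fin k, ⋂ _ : i < j, {t | t i < t j} := by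
    ext t; simp [StrictMono]
  change MeasurableSet {t : Fin k → ℝ | StrictMono t}
  rw [this]
  exact MeasurableSet.iInter fun i => MeasurableSet.iInter fun j => MeasurableSet.iInter fun _ =>
    measurableSet_lt (by fun_prop) (by fun_prop)

theorem volume_ordSimplex (k : ℕ) (L : ℝ) (hL : 0 ≤ L) :
    (volume (ordSimplex k L)) = ENNReal.ofReal (L ^ k / Nat.factorial k) := by
  classical
  have h := perm_sum (ordSimplex k L) {t | ∀ i, t i ∈ Icc (0:ℝ) L} (measurableSet_ordSimplex k L)
    (measurableSet_box L) 1 (by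
      filter_upwards [ae_injective k] with t ht
      split_ifs with hb
      · rw [Finset.card_eq_one]
        refine ⟨Tuple.sort t, ?_⟩
        ext e
        simp only [Finset.mem_filter, Finset.mem_univ, true_and, Finset.mem_singleton]
        constructor
        · intro he
          have := Tuple.unique_monotone he.2.monotone (Tuple.monotone_sort t)
          ext i
          exact congrArg _ (ht (congrFun this i))
        · rintro rfl
          refine ⟨fun i => hb _, ?_⟩
          exact (Tuple.monotone_sort t).strictMono_of_injective
            (ht.comp (Tuple.sort t).injective)
      · rw [Finset.card_eq_zero, Finset.filter_eq_empty_iff]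
        intro e _ he
        apply hb
        intro i
        have := he.1 (e.symm i)
        simpa using this)
  have hbox : volume {t : Fin k → ℝ | ∀ i, t i ∈ Icc (0:ℝ) L} = ENNReal.ofReal (L ^ k) := by
    have : {x : Fin k → ℝ | ∀ i, x i ∈ Icc (0:ℝ) L} = univ.pi fun _ => Icc (0:ℝ) L := by
      ext x; simp only [Set.mem_pi, Set.mem_univ, true_imp_iff, Set.mem_ofPred_eq]
    rw [this, volume_pi_pi]
    simp [ENNReal.ofReal_pow hL]
  rw [hbox] at h
  simp only [Fintype.card_fin, Nat.cast_one, one_mul] at h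
  rw [ENNReal.ofReal_div_of_pos (by positivity), ← h, ENNReal.ofReal_natCast,
    mul_comm, ENNReal.mul_div_cancel_right]
  · exact_mod_cast Nat.factorial_ne_zero k
  · exact ENNReal.natCast_ne_top _


/-- Indecomposability of the relation induced by a tuple. -/
theorem brick_split {α : Type*} [PartialOrder α] (hb : IsBrick α) {x : α → ℝ} (hx : x ∈ RS α)
    (A : Set α) (h1 : ∃ a, a ∈ A) (h2 : ∃ b, b ∉ A) :
    ∃ a ∈ A, ∃ b, b ∉ A ∧ ¬ (x a + 1 < x b) := by
  by_contra! hcon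
  obtain ⟨e, he⟩ := hx
  apply hb
  refine ⟨e ⁻¹' A, (e ⁻¹' A)ᶜ, ?_, ?_, fun x => em _, fun x hx => hx.2 hx.1, ?_⟩
  · obtain ⟨a, ha⟩ := h1
    exact ⟨e.symm a, by simpa using ha⟩
  · obtain ⟨a, ha⟩ := h2
    exact ⟨e.symm a, by simpa using ha⟩
  · intro a ha b hb
    rw [he]
    exact hcon _ ha _ hb

theorem brick_diam {α : Type*} [Fintype α] [PartialOrder α] (hb : IsBrick α) {x : α → ℝ}
    (hx : x ∈ RS α) (a b : α) : x b ≤ x a + Fintype.card α := by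
  by_contra! hcon
  have h : ∀ j : Fin (Fintype.card α), ∃ c, x a + j < x c ∧ x c ≤ x a + j + 1 := by
    intro j
    by_contra! hj
    obtain ⟨c, hc, d, hd, hcd⟩ := brick_split hb hx {c | x c ≤ x a + j} ⟨a, by simp⟩
      ⟨b, by
        have : ((j : ℕ) : ℝ) ≤ Fintype.card α := by exact_mod_cast j.2.le
        simp only [mem_ofPred_eq, not_le]; linarith⟩
    simp only [mem_ofPred_eq, not_le] at hc hd
    have := hj d hd
    apply hcd
    linarith
  choose f hf1 hf2 using h
  have hinj : Function.Injective f := by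
    intro i j hij
    have h1 := hf1 i
    have h2 := hf2 i
    have h3 := hf1 j
    have h4 := hf2 j
    rw [hij] at h1 h2
    have h5 : ((i : ℕ) : ℝ) < (j : ℕ) + 1 := by linarith
    have h6 : ((j : ℕ) : ℝ) < (i : ℕ) + 1 := by linarith
    have h5' : (i : ℕ) < j + 1 := by exact_mod_cast h5
    have h6' : (j : ℕ) < i + 1 := by exact_mod_cast h6
    ext; omega
  have hsurj := ((Fintype.bijective_iff_injective_and_card f).2 ⟨hinj, by simp⟩).2
  obtain ⟨j, hj⟩ := hsurj a
  have := hf1 j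
  rw [hj] at this
  have : (0:ℝ) ≤ (j : ℕ) := by positivity
  linarith

/-- `f` is a brick decomposition of the order induced by `y`. -/
structure Good {α : Type*} {k : ℕ} (f : α → Fin k) (y : α → ℝ) : Prop where
  surj : Function.Surjective f
  mono : ∀ a b, f a < f b → y a + 1 < y b
  split : ∀ i, ∀ A : Set α, (∃ a ∈ A, f a = i) → (∃ b, b ∉ A ∧ f b = i) →
    ∃ a ∈ A, ∃ b, b ∉ A ∧ f a = i ∧ f b = i ∧ ¬ (y a + 1 < y b)

theorem Good.const {α : Type*} {k : ℕ} {f f' : α → Fin k} {y : α → ℝ} (h : Good f y)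
    (h' : Good f' y) (a b : α) (hab : f a = f b) : f' a ≤ f' b := by
  by_contra! hlt
  obtain ⟨c, hc, d, hd, -, -, hcd⟩ := h.split (f a) {c | f' c ≤ f' b} ⟨b, by simp, hab.symm⟩
    ⟨a, by simpa using hlt, rfl⟩
  simp only [mem_ofPred_eq, not_le] at hc hd
  exact hcd (h'.mono _ _ (hc.trans_lt hd))

theorem Good.unique {α : Type*} {k : ℕ} {f f' : α → Fin k} {y : α → ℝ} (h : Good f y)
    (h' : Good f' y) : f = f' := by
  choose s hs using h.surj
  have key : ∀ a, f' (s (f a)) = f' a := fun a =>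
    le_antisymm (h.const h' _ _ (hs _)) (h.const h' _ _ (hs _).symm)
  have hmono : StrictMono fun i => f' (s i) := by
    intro i j hij
    have h1 := h.mono (s i) (s j) (by simpa [hs] using hij)
    refine lt_of_le_of_ne ?_ ?_
    · by_contra! hlt
      have := h'.mono _ _ hlt
      linarith
    · intro heq
      have := h'.const h _ _ heq.symm
      simp only [hs] at this
      exact absurd hij (not_lt.2 this)
  funext a
  rw [← key a]
  exact le_antisymm hmono.le_apply hmono.apply_le

theorem Good.comp_perm {α : Type*} {k : ℕ} {f : α → Fin k} {y : α → ℝ} (g : Equiv.Perm α)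
    (h : Good f (y ∘ g)) : Good (f ∘ g.symm) y where
  surj := h.surj.comp g.symm.surjective
  mono a b hab := by simpa using h.mono _ _ hab
  split := by
    rintro i A ⟨a, ha, ha'⟩ ⟨b, hb, hb'⟩
    obtain ⟨c, hc, d, hd, h1, h2, h3⟩ := h.split i (g ⁻¹' A) ⟨g.symm a, by simpa using ha, ha'⟩
      ⟨g.symm b, by simpa using hb, hb'⟩
    exact ⟨g c, hc, g d, hd, by simpa using h1, by simpa using h2, h3⟩

section Sig

set_option linter.unusedSectionVars false

variable {k : ℕ} {P : Fin k → Type} [∀ i, Fintype (P i)] [∀ i, PartialOrder (P i)]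

/-- Ordered block configurations. -/
def TS (P : Fin k → Type) [∀ i, PartialOrder (P i)] (L : ℝ) : Set ((Σ i, P i) → ℝ) :=
  {x | (∀ p, x p ∈ Icc (0:ℝ) L) ∧ (∀ i, (fun a => x ⟨i, a⟩) ∈ RS (P i)) ∧
    ∀ i j, i < j → ∀ a b, x ⟨i, a⟩ + 1 < x ⟨j, b⟩}

/-- All configurations representing the lexicographic sum. -/
def SS (P : Fin k → Type) [∀ i, PartialOrder (P i)] (L : ℝ) : Set ((Σ i, P i) → ℝ) :=
  {x | (∀ p, x p ∈ Icc (0:ℝ) L) ∧ ∃ e : (Σ i, P i) ≃ (Σ i, P i), ∀ a b : (Σ i, P i),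
    Sigma.Lex (· < ·) (fun _ => (· < ·)) a b ↔ x (e a) + 1 < x (e b)}

theorem measurableSet_SS (L : ℝ) : MeasurableSet (SS P L) :=
  (measurableSet_box L).inter (measurableSet_rel _)

theorem measurableSet_TS (L : ℝ) : MeasurableSet (TS P L) := by
  refine (measurableSet_box L).inter (MeasurableSet.inter ?_ ?_)
  · change MeasurableSet {x : (Σ i, P i) → ℝ | ∀ i, (fun a => x ⟨i, a⟩) ∈ RS (P i)}
    rw [ofPred_forall]
    refine MeasurableSet.iInter fun i => ?_
    exact (measurable_pi_lambda _ fun a => measurable_pi_apply _ :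
      Measurable fun (x : (Σ i, P i) → ℝ) (a : P i) => x ⟨i, a⟩) (measurableSet_RS (P i))
  · change MeasurableSet {x : (Σ i, P i) → ℝ | ∀ i j, i < j → ∀ a b, x ⟨i, a⟩ + 1 < x ⟨j, b⟩}
    simp only [ofPred_forall]
    exact MeasurableSet.iInter fun i => MeasurableSet.iInter fun j => MeasurableSet.iInter fun _ =>
      MeasurableSet.iInter fun a => MeasurableSet.iInter fun b =>
      measurableSet_lt (by fun_prop) (by fun_prop)

theorem TS_good [∀ i, Nonempty (P i)] (hb : ∀ i, IsBrick (P i)) {L : ℝ} {y : (Σ i, P i) → ℝ}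
    (hy : y ∈ TS P L) : Good (Sigma.fst : (Σ i, P i) → Fin k) y where
  surj i := ⟨⟨i, Classical.arbitrary _⟩, rfl⟩
  mono a b hab := hy.2.2 _ _ hab _ _
  split := by
    rintro i A ⟨⟨_, a⟩, ha, rfl⟩ ⟨⟨_, b⟩, hb', rfl⟩
    obtain ⟨c, hc, d, hd, h⟩ := brick_split (hb _) (hy.2.1 _) {c | (⟨_, c⟩ : Σ i, P i) ∈ A} ⟨a, ha⟩ ⟨b, hb'⟩
    exact ⟨⟨_, c⟩, hc, ⟨_, d⟩, hd, rfl, rfl, h⟩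

theorem RS_perm {α : Type*} [Preorder α] {x : α → ℝ} (hx : x ∈ RS α) (g : Equiv.Perm α) :
    x ∘ g ∈ RS α := by
  obtain ⟨e, he⟩ := hx
  exact ⟨e.trans g.symm, fun a b => by simpa using he a b⟩

theorem TS_stab {L : ℝ} {y : (Σ i, P i) → ℝ} (hy : y ∈ TS P L) (g : Equiv.Perm (Σ i, P i))
    (hg : Sigma.fst ∘ g = (Sigma.fst : (Σ i, P i) → Fin k)) : y ∘ g ∈ TS P L := by
  have h : ∀ i (a : P i), ∃ b : P i, g ⟨i, a⟩ = ⟨i, b⟩ := by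
    intro i a
    have := congrFun hg ⟨i, a⟩
    rcases hga : g ⟨i, a⟩ with ⟨j, b⟩
    simp only [Function.comp, hga] at this
    subst this
    exact ⟨b, rfl⟩
  choose γ hγ using h
  refine ⟨fun p => hy.1 _, fun i => ?_, fun i j hij a b => ?_⟩
  · have hinj : Function.Injective (γ i) := by
      intro a b hab
      have : g ⟨i, a⟩ = g ⟨i, b⟩ := by rw [hγ, hγ, hab]
      simpa using g.injective this
    have := RS_perm (hy.2.1 i) (Equiv.ofBijective _ (Finite.injective_iff_bijective.1 hinj))
    convert this using 1
    funext a
    simp [hγ]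
  · simp only [Function.comp, hγ]
    exact hy.2.2 i j hij _ _

theorem TS_sub_SS {L : ℝ} {x : (Σ i, P i) → ℝ} (e : Equiv.Perm (Σ i, P i))
    (hx : x ∘ e ∈ TS P L) : x ∈ SS P L := by
  refine ⟨fun p => by simpa using hx.1 (e.symm p), ?_⟩
  choose f hf using hx.2.1
  refine ⟨(Equiv.sigmaCongrRight f).trans e, ?_⟩
  rintro ⟨i, a⟩ ⟨j, b⟩
  simp only [Equiv.trans_apply, Equiv.sigmaCongrRight_apply, Sigma.map, id]
  rw [Sigma.lex_iff]
  rcases lt_trichotomy i j with h | h | h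
  · simp only [h, true_or, true_iff]
    exact hx.2.2 i j h _ _
  · subst h
    simp only [lt_irrefl, false_or, exists_true_left]
    exact hf i a b
  · have h1 := hx.2.2 j i h (f j b) (f i a)
    simp only [Function.comp] at h1
    have h2 : ¬ i < j := h.not_gt
    have h3 : i ≠ j := h.ne'
    simp only [h2, h3, false_or, IsEmpty.exists_iff, false_iff]
    linarith

theorem SS_exists {L : ℝ} {x : (Σ i, P i) → ℝ} (hx : x ∈ SS P L) :
    ∃ e : Equiv.Perm (Σ i, P i), x ∘ e ∈ TS P L := by
  obtain ⟨hL, e, he⟩ := hx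
  refine ⟨e, fun p => hL _, fun i => ⟨Equiv.refl _, fun a b => ?_⟩, fun i j hij a b => ?_⟩
  · have := he ⟨i, a⟩ ⟨i, b⟩
    rw [Sigma.lex_iff] at this
    simpa using this
  · exact (he _ _).1 (Sigma.Lex.left _ _ hij)

theorem volume_SS [∀ i, Nonempty (P i)] (hb : ∀ i, IsBrick (P i)) (L : ℝ) :
    (Nat.factorial (∑ i, Fintype.card (P i)) : ENNReal) * volume (TS P L)
      = ((∏ i, Nat.factorial (Fintype.card (P i)) : ℕ) : ENNReal) * volume (SS P L) := by
  classical
  have := perm_sum (TS P L) (SS P L) (measurableSet_TS L) (measurableSet_SS L)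
    (∏ i, Nat.factorial (Fintype.card (P i))) (by
      refine Eventually.of_forall fun x => ?_
      split_ifs with hx
      · obtain ⟨e, he⟩ := SS_exists hx
        have h1 := DomMulAct.stabilizer_card (f := (Sigma.fst : (Σ i, P i) → Fin k))
        have h2 : ∀ i, Fintype.card {a : Σ i, P i // a.1 = i} = Fintype.card (P i) := fun i =>
          Fintype.card_congr (Equiv.sigmaSubtype i)
        simp only [h2] at h1
        rw [← h1, Fintype.card_subtype]
        symm
        refine Finset.card_bij (fun g _ => e * g) ?_ ?_ ?_
        · intro g hg
          simp only [Finset.mem_filter, Finset.mem_univ, true_and] at hg ⊢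
          exact TS_stab he g hg
        · intro g _ g' _ h
          exact mul_left_cancel h
        · intro e' he'
          simp only [Finset.mem_filter, Finset.mem_univ, true_and] at he'
          refine ⟨e⁻¹ * e', ?_, by simp⟩
          simp only [Finset.mem_filter, Finset.mem_univ, true_and]
          have g1 := TS_good hb he
          have g2 := TS_good hb he'
          have e3 : x ∘ e' = (x ∘ e) ∘ (e⁻¹ * e' : Equiv.Perm _) := by
            funext p; simp
          rw [e3] at g2
          generalize (e⁻¹ * e' : Equiv.Perm _) = g at g2
          have := g1.unique g2.comp_perm
          funext p
          have := congrFun this (g p)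
          simpa using this
      · rw [Finset.card_eq_zero, Finset.filter_eq_empty_iff]
        exact fun e _ he => hx (TS_sub_SS e he))
  rwa [Fintype.card_sigma] at this

end Sig

theorem anchor_measure {α : Type*} [Fintype α] [PartialOrder α] (hb : IsBrick α) (a0 : α) :
    ∃ C : NNReal, ((volume : Measure (α → ℝ)).restrict (RS α)).map (fun x => x a0)
      = C • (volume : Measure ℝ) := by
  set ν := ((volume : Measure (α → ℝ)).restrict (RS α)).map (fun x => x a0) with hν
  have happ : ∀ B : Set ℝ, MeasurableSet B → ν B = volume ({x : α → ℝ | x a0 ∈ B} ∩ RS α) := by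
    intro B hB
    rw [hν, Measure.map_apply (measurable_pi_apply a0) hB,
      Measure.restrict_apply (measurable_pi_apply a0 hB)]
    rfl
  have h1 : IsFiniteMeasureOnCompacts ν := by
    refine ⟨fun K hK => ?_⟩
    obtain ⟨R, hR⟩ := hK.isBounded.subset_closedBall (0 : ℝ)
    rw [happ K hK.measurableSet]
    set D : ℝ := (Fintype.card α : ℝ)
    refine lt_of_le_of_lt (measure_mono (t := univ.pi fun _ => Icc (-R - D) (R + D)) ?_) ?_
    · rintro x ⟨hxK, hx⟩ a -
      have h := hR hxK
      rw [Metric.mem_closedBall, dist_zero_right, Real.norm_eq_abs, abs_le] at h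
      have h2 := brick_diam hb hx a a0
      have h3 := brick_diam hb hx a0 a
      constructor <;> simp only [D] <;> linarith [h.1, h.2]
    · rw [volume_pi_pi]
      simp only [Real.volume_Icc]
      exact ENNReal.prod_lt_top fun _ _ => ENNReal.ofReal_lt_top
  have h2 : ν.IsAddLeftInvariant := by
    refine ⟨fun t => ?_⟩
    refine Measure.ext fun B hB => ?_
    have hB' : MeasurableSet ((fun s => t + s) ⁻¹' B) := measurable_const_add t hB
    rw [Measure.map_apply (measurable_const_add t) hB, happ _ hB', happ _ hB]
    rw [← measure_preimage_add volume (fun _ : α => t) ({x : α → ℝ | x a0 ∈ B} ∩ RS α)]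
    congr 1
    ext x
    have : x ∈ RS α ↔ (fun _ : α => t) + x ∈ RS α := by
      simp only [RS, mem_ofPred_eq, Pi.add_apply, add_assoc, add_lt_add_iff_left]
    simp only [mem_inter_iff, mem_preimage, mem_ofPred_eq, Pi.add_apply, ← this]
  exact ⟨_, Measure.isAddLeftInvariant_eq_smul ν volume⟩

theorem anchor_const {α : Type*} [Fintype α] [PartialOrder α] (hb : IsBrick α) (a0 : α)
    (c : ℝ) (hlim : Tendsto (fun L : ℝ => genVol (fun a b : α => a < b) L / L) atTop (nhds c)) :
    ((volume : Measure (α → ℝ)).restrict (RS α)).map (fun x => x a0)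
      = c.toNNReal • (volume : Measure ℝ) := by
  obtain ⟨C, hC⟩ := anchor_measure hb a0
  suffices h : Tendsto (fun L : ℝ => genVol (fun a b : α => a < b) L / L) atTop (nhds C) by
    have := tendsto_nhds_unique hlim h
    rw [this, Real.toNNReal_coe, hC]
  have happ : ∀ B : Set ℝ, MeasurableSet B →
      volume ({x : α → ℝ | x a0 ∈ B} ∩ RS α) = C * volume B := by
    intro B hB
    have := congrArg (fun μ : Measure ℝ => μ B) hC
    rw [Measure.map_apply (measurable_pi_apply a0) hB,
      Measure.restrict_apply (measurable_pi_apply a0 hB)] at this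
    exact this
  set D : ℝ := (Fintype.card α : ℝ) with hD
  have hup : ∀ L : ℝ, 0 ≤ L → genVol (fun a b : α => a < b) L ≤ C * L := by
    intro L hL
    refine ENNReal.toReal_le_of_le_ofReal (by positivity) ?_
    rw [ENNReal.ofReal_mul (by positivity), ENNReal.ofReal_coe_nnreal]
    have := happ (Icc 0 L) measurableSet_Icc
    rw [Real.volume_Icc, sub_zero] at this
    rw [← this]
    exact measure_mono fun x hx => ⟨hx.1 a0, hx.2⟩
  have hfin : ∀ L : ℝ, volume {x : α → ℝ | (∀ i, x i ∈ Icc (0:ℝ) L) ∧ x ∈ RS α} ≠ ⊤ := by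
    intro L
    refine ne_top_of_le_ne_top ?_ (measure_mono (t := {x : α → ℝ | x a0 ∈ Icc 0 L} ∩ RS α)
      fun x hx => ⟨hx.1 a0, hx.2⟩)
    rw [happ _ measurableSet_Icc, Real.volume_Icc]
    exact ENNReal.mul_ne_top ENNReal.coe_ne_top ENNReal.ofReal_ne_top
  have hlow : ∀ L : ℝ, 2 * D ≤ L → C * (L - 2 * D) ≤ genVol (fun a b : α => a < b) L := by
    intro L hL
    refine (ENNReal.ofReal_le_iff_le_toReal (hfin L)).1 ?_
    rw [ENNReal.ofReal_mul (by positivity), ENNReal.ofReal_coe_nnreal]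
    have := happ (Icc D (L - D)) measurableSet_Icc
    rw [Real.volume_Icc, show L - D - D = L - 2 * D by ring] at this
    rw [← this]
    refine measure_mono fun x hx => ⟨fun a => ?_, hx.2⟩
    have h2 := brick_diam hb hx.2 a a0
    have h3 := brick_diam hb hx.2 a0 a
    have h4 : x a0 ∈ Icc D (L - D) := hx.1
    constructor <;> linarith [h4.1, h4.2]
  have hl : Tendsto (fun L : ℝ => C * (L - 2 * D) / L) atTop (nhds C) := by
    have h1 : Tendsto (fun L : ℝ => (C : ℝ) - C * (2 * D) / L) atTop (nhds (C - 0)) :=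
      tendsto_const_nhds.sub (tendsto_const_nhds.div_atTop tendsto_id)
    rw [sub_zero] at h1
    refine h1.congr' ?_
    filter_upwards [eventually_gt_atTop 0] with L hL
    field_simp
  refine tendsto_of_tendsto_of_tendsto_of_le_of_le' hl tendsto_const_nhds ?_ ?_
  · filter_upwards [eventually_ge_atTop (2 * D), eventually_gt_atTop 0] with L h1 h2
    gcongr
    exact hlow L h1
  · filter_upwards [eventually_gt_atTop 0] with L hL
    rw [div_le_iff₀ hL]
    exact hup L hL.le

section Sig2

variable {k : ℕ} {P : Fin k → Type} [∀ i, Fintype (P i)] [∀ i, PartialOrder (P i)]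

theorem curry_preserving (P : Fin k → Type) [∀ i, Fintype (P i)] :
    (volume : Measure (∀ i, P i → ℝ)).map (fun x (p : Σ i, P i) => x p.1 p.2) = volume := by
  symm
  refine Measure.pi_eq fun s hs => ?_
  have hm : Measurable fun (x : ∀ i, P i → ℝ) (p : Σ i, P i) => x p.1 p.2 := by
    fun_prop
  rw [Measure.map_apply hm (MeasurableSet.univ_pi hs)]
  have : (fun (x : ∀ i, P i → ℝ) (p : Σ i, P i) => x p.1 p.2) ⁻¹' univ.pi s
      = univ.pi fun i => univ.pi fun a => s ⟨i, a⟩ := by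
    ext x
    simp only [mem_preimage, Set.mem_pi, mem_univ, true_imp_iff, Sigma.forall]
  rw [this, volume_pi_pi, Fintype.prod_sigma]
  simp only [volume_pi_pi]

theorem pi_smul_volume (C : Fin k → NNReal) :
    Measure.pi (fun i => C i • (volume : Measure ℝ))
      = (∏ i, C i) • (volume : Measure (Fin k → ℝ)) := by
  refine Measure.pi_eq fun s hs => ?_
  simp only [Measure.smul_apply, volume_pi_pi]
  simp only [ENNReal.smul_def, smul_eq_mul, Finset.prod_mul_distrib, ENNReal.ofNNReal_finsetProd]

theorem anchor_prod (a0 : ∀ i, P i) (C : Fin k → NNReal)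
    (hC : ∀ i, ((volume : Measure (P i → ℝ)).restrict (RS (P i))).map (fun x => x (a0 i))
      = C i • (volume : Measure ℝ)) (B : Set (Fin k → ℝ)) (hB : MeasurableSet B) :
    volume {x : (Σ i, P i) → ℝ | (∀ i, (fun a => x ⟨i, a⟩) ∈ RS (P i)) ∧
      (fun i => x ⟨i, a0 i⟩) ∈ B} = ((∏ i, C i : NNReal) : ENNReal) * volume B := by
  have hm : Measurable fun (x : ∀ i, P i → ℝ) (p : Σ i, P i) => x p.1 p.2 := by
    fun_prop
  have hev : Measurable fun (x : ∀ i, P i → ℝ) (i : Fin k) => x i (a0 i) := by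
    fun_prop
  have hev' : Measurable fun (x : (Σ i, P i) → ℝ) (i : Fin k) => x ⟨i, a0 i⟩ := by
    fun_prop
  have hset : MeasurableSet {x : (Σ i, P i) → ℝ | (∀ i, (fun a => x ⟨i, a⟩) ∈ RS (P i)) ∧
      (fun i => x ⟨i, a0 i⟩) ∈ B} := by
    refine MeasurableSet.inter ?_ (hev' hB)
    change MeasurableSet {x : (Σ i, P i) → ℝ | ∀ i, (fun a => x ⟨i, a⟩) ∈ RS (P i)}
    rw [ofPred_forall]
    refine MeasurableSet.iInter fun i => ?_
    exact (measurable_pi_lambda _ fun a => measurable_pi_apply _ :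
      Measurable fun (x : (Σ i, P i) → ℝ) (a : P i) => x ⟨i, a⟩) (measurableSet_RS (P i))
  rw [← curry_preserving P, Measure.map_apply hm hset]
  have hsf : ∀ i, SigmaFinite
      (((volume : Measure (P i → ℝ)).restrict (RS (P i))).map (fun x => x (a0 i))) := by
    intro i; rw [hC i]; infer_instance
  have h1 := Measure.pi_map_pi (μ := fun i => (volume : Measure (P i → ℝ)).restrict (RS (P i)))
    (f := fun i (x : P i → ℝ) => x (a0 i)) (fun i => (measurable_pi_apply (a0 i)).aemeasurable)
  simp only [hC] at h1
  rw [pi_smul_volume] at h1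
  have h2 := congrArg (fun μ : Measure (Fin k → ℝ) => μ B) h1
  rw [Measure.map_apply hev hB, ← Measure.restrict_pi_pi, Measure.restrict_apply (hev hB)] at h2
  rw [Measure.smul_apply, ENNReal.smul_def, smul_eq_mul] at h2
  rw [← h2]
  congr 1
  ext x
  simp only [mem_preimage, mem_ofPred_eq, mem_inter_iff, Set.mem_pi, mem_univ, true_imp_iff]
  exact and_comm

theorem TS_upper (a0 : ∀ i, P i) (C : Fin k → NNReal)
    (hC : ∀ i, ((volume : Measure (P i → ℝ)).restrict (RS (P i))).map (fun x => x (a0 i))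
      = C i • (volume : Measure ℝ)) (L : ℝ) (hL : 0 ≤ L) :
    volume (TS P L) ≤ ENNReal.ofReal ((∏ i, (C i : ℝ)) * (L ^ k / Nat.factorial k)) := by
  have h := anchor_prod a0 C hC (ordSimplex k L) (measurableSet_ordSimplex k L)
  rw [volume_ordSimplex k L hL] at h
  have e : ENNReal.ofReal ((∏ i, (C i : ℝ)) * (L ^ k / Nat.factorial k))
      = ((∏ i, C i : NNReal) : ENNReal) * ENNReal.ofReal (L ^ k / Nat.factorial k) := by
    rw [ENNReal.ofReal_mul (by positivity), ← NNReal.coe_prod, ENNReal.ofReal_coe_nnreal]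
  rw [e, ← h]
  refine measure_mono fun x hx => ⟨hx.2.1, fun i => hx.1 _, fun i j hij => ?_⟩
  have := hx.2.2 i j hij (a0 i) (a0 j)
  show x _ < x _
  linarith

theorem TS_lower (hb : ∀ i, IsBrick (P i)) (a0 : ∀ i, P i) (C : Fin k → NNReal)
    (hC : ∀ i, ((volume : Measure (P i → ℝ)).restrict (RS (P i))).map (fun x => x (a0 i))
      = C i • (volume : Measure ℝ)) (D : ℝ) (hD0 : 0 ≤ D)
    (hD : ∀ i, (Fintype.card (P i) : ℝ) ≤ D) (L : ℝ) (hL : 2 * D + k * (2 * D + 1) ≤ L) :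
    ENNReal.ofReal ((∏ i, (C i : ℝ)) * ((L - (2 * D + k * (2 * D + 1))) ^ k / Nat.factorial k))
      ≤ volume (TS P L) := by
  set M : ℝ := L - (2 * D + k * (2 * D + 1)) with hM
  have hM0 : 0 ≤ M := by linarith
  set v : Fin k → ℝ := fun i => -(D + i * (2 * D + 1)) with hv
  have hmeas : MeasurableSet ((fun t => v + t) ⁻¹' ordSimplex k M) :=
    measurable_const_add v (measurableSet_ordSimplex k M)
  have h := anchor_prod a0 C hC _ hmeas
  rw [measure_preimage_add, volume_ordSimplex k M hM0] at h
  have e : ENNReal.ofReal ((∏ i, (C i : ℝ)) * (M ^ k / Nat.factorial k))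
      = ((∏ i, C i : NNReal) : ENNReal) * ENNReal.ofReal (M ^ k / Nat.factorial k) := by
    rw [ENNReal.ofReal_mul (by positivity), ← NNReal.coe_prod, ENNReal.ofReal_coe_nnreal]
  rw [e, ← h]
  refine measure_mono fun x hx => ?_
  obtain ⟨hx1, hx2, hx3⟩ := hx
  have near : ∀ i (a : P i), x ⟨i, a⟩ ≤ x ⟨i, a0 i⟩ + D ∧ x ⟨i, a0 i⟩ ≤ x ⟨i, a⟩ + D := by
    intro i a
    have h1 := brick_diam (hb i) (hx1 i) a (a0 i)
    have h2 := brick_diam (hb i) (hx1 i) (a0 i) a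
    constructor <;> linarith [hD i]
  refine ⟨?_, hx1, ?_⟩
  · rintro ⟨i, a⟩
    have h1 := hx2 i
    simp only [hv, Pi.add_apply, mem_Icc] at h1
    have hi : ((i : ℕ) : ℝ) ≤ k := by exact_mod_cast i.2.le
    have hi0 : (0 : ℝ) ≤ (i : ℕ) := by positivity
    have h2 : ((i : ℕ) : ℝ) * (2 * D + 1) ≤ k * (2 * D + 1) := by gcongr
    have h3 : 0 ≤ ((i : ℕ) : ℝ) * (2 * D + 1) := by positivity
    have := near i a
    constructor <;> linarith [this.1, this.2, h1.1, h1.2]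
  · intro i j hij a b
    have h1 := hx3 hij
    simp only [hv, Pi.add_apply] at h1
    have h2 : ((i : ℕ) : ℝ) + 1 ≤ (j : ℕ) := by exact_mod_cast hij
    have h3 : (((i : ℕ) : ℝ) + 1) * (2 * D + 1) ≤ (j : ℕ) * (2 * D + 1) := by gcongr
    linarith [(near i a).1, (near j b).2]

end Sig2

end LexVol

/-- For a lexicographic sum `P` of bricks `P₁, …, P_k` over the `k`-chain,
`V_P(L)/L^k` converges to the multinomial coefficient times `c₁⋯c_k/k!`. -/
theorem lex_sum_of_bricks_volume_limit (k : ℕ) (hk : 1 ≤ k)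
    (P : Fin k → Type) [∀ i, Fintype (P i)] [∀ i, PartialOrder (P i)]
    (hsem : ∀ i, IsSemiorder (P i)) (hbrick : ∀ i, IsBrick (P i))
    (c : Fin k → ℝ) (hc : ∀ i, 0 < c i)
    (hlim : ∀ i, Tendsto (fun L : ℝ => genVol (fun a b : P i => a < b) L / L)
      atTop (nhds (c i))) :
    Tendsto (fun L : ℝ => genVol (fun a b : Σₗ i, P i => a < b) L / L ^ k) atTop
      (nhds (((Nat.factorial (∑ i, Fintype.card (P i)) : ℝ) /
          ∏ i, (Nat.factorial (Fintype.card (P i)) : ℝ)) *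
        ((∏ i, c i) / (Nat.factorial k : ℝ)))) := by
  classical
  have hne : ∀ i, Nonempty (P i) := by
    intro i
    by_contra hemp
    rw [not_nonempty_iff] at hemp
    have h0 : ∀ L : ℝ, genVol (fun a b : P i => a < b) L = 1 := by
      intro L
      have : {x : P i → ℝ | (∀ i, x i ∈ Icc (0:ℝ) L) ∧
          ∃ e : P i ≃ P i, ∀ a b : P i, a < b ↔ x (e a) + 1 < x (e b)} = univ := by
        ext x
        simp only [mem_univ, iff_true]
        exact ⟨fun j => isEmptyElim j, Equiv.refl _, fun a => isEmptyElim a⟩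
      unfold genVol
      rw [this]
      simp [volume_pi]
    have h1 : Tendsto (fun L : ℝ => genVol (fun a b : P i => a < b) L / L) atTop (nhds 0) := by
      simp only [h0]
      exact tendsto_const_nhds.div_atTop tendsto_id
    have := tendsto_nhds_unique (hlim i) h1
    have := hc i
    linarith
  have a0 : ∀ i, P i := fun i => Classical.arbitrary _
  have hC := fun i => LexVol.anchor_const (hbrick i) (a0 i) (c i) (hlim i)
  have hCc : ∀ i, (((c i).toNNReal : NNReal) : ℝ) = c i := fun i =>
    Real.coe_toNNReal _ (hc i).le
  set D : ℝ := ∑ i, (Fintype.card (P i) : ℝ) with hDdef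
  have hD0 : 0 ≤ D := Finset.sum_nonneg fun i _ => by positivity
  have hD : ∀ i, (Fintype.card (P i) : ℝ) ≤ D := fun i =>
    Finset.single_le_sum (f := fun i => (Fintype.card (P i) : ℝ))
      (fun i _ => by positivity) (Finset.mem_univ i)
  have hup := LexVol.TS_upper a0 _ hC
  have hlow := LexVol.TS_lower hbrick a0 _ hC D hD0 hD
  simp only [hCc] at hup hlow
  set E : ℝ := 2 * D + k * (2 * D + 1) with hE
  have hcp : 0 ≤ ∏ i, c i := Finset.prod_nonneg fun i _ => (hc i).le
  have hT : Tendsto (fun L : ℝ => (volume (LexVol.TS P L)).toReal / L ^ k) atTop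
      (nhds ((∏ i, c i) / (Nat.factorial k : ℝ))) := by
    have hl : Tendsto (fun L : ℝ => ((∏ i, c i) * ((L - E) ^ k / Nat.factorial k)) / L ^ k)
        atTop (nhds ((∏ i, c i) / (Nat.factorial k : ℝ))) := by
      have h1 : Tendsto (fun L : ℝ => ((∏ i, c i) / (Nat.factorial k : ℝ)) * (1 - E / L) ^ k)
          atTop (nhds (((∏ i, c i) / (Nat.factorial k : ℝ)) * (1 - 0) ^ k)) :=
        tendsto_const_nhds.mul
          ((tendsto_const_nhds.sub (tendsto_const_nhds.div_atTop tendsto_id)).pow k)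
      rw [sub_zero, one_pow, mul_one] at h1
      refine h1.congr' ?_
      filter_upwards [eventually_gt_atTop 0] with L hL
      have : 1 - E / L = (L - E) / L := by field_simp
      rw [this, div_pow]
      ring
    refine tendsto_of_tendsto_of_tendsto_of_le_of_le' hl tendsto_const_nhds ?_ ?_
    · filter_upwards [eventually_ge_atTop E, eventually_gt_atTop 0] with L h1 h2
      gcongr
      exact (ENNReal.ofReal_le_iff_le_toReal
        (ne_top_of_le_ne_top ENNReal.ofReal_ne_top (hup L h2.le))).1 (hlow L h1)
    · filter_upwards [eventually_gt_atTop 0] with L hL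
      rw [div_le_iff₀ (by positivity)]
      refine (ENNReal.toReal_le_of_le_ofReal (by positivity) (hup L hL.le)).trans (le_of_eq ?_)
      ring
  refine (hT.const_mul _).congr fun L => ?_
  have h1 := congrArg ENNReal.toReal (LexVol.volume_SS (P := P) hbrick L)
  rw [ENNReal.toReal_mul, ENNReal.toReal_mul, ENNReal.toReal_natCast, ENNReal.toReal_natCast,
    Nat.cast_prod] at h1
  have h2 : genVol (fun a b : Σₗ i, P i => a < b) L = (volume (LexVol.SS P L)).toReal := by
    rfl
  rw [h2]
  have h3 : (∏ i, (Nat.factorial (Fintype.card (P i)) : ℝ)) ≠ 0 :=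
    Finset.prod_ne_zero_iff.2 fun i _ => by positivity
  rw [← mul_div_assoc, div_mul_eq_mul_div, h1, mul_div_cancel_left₀ _ h3]
end

section
/- Let P₁, …, P_k be finite semiorders with |P_i| = n_i and n = n₁ + ⋯ + n_k, and let P be their lexicographic sum over the k-chain. Suppose that for each i there are a constant c_i > 0 and a positive integer e_i with lim_{L→∞} V_{P_i}(L)/L^{e_i} = c_i. Then V_P(L) = Θ(L^{e₁+⋯+e_k}) as L → ∞; that is, there exist constants 0 < a ≤ b and L₀ such that a·L^{e₁+⋯+e_k} ≤ V_P(L) ≤ b·L^{e₁+⋯+e_k} for all L ≥ L₀. -/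
open MeasureTheory Set Filter

/-- Labelled version of the configuration set. -/
def labSet {α : Type*} (r : α → α → Prop) (L : ℝ) : Set (α → ℝ) :=
  {x | (∀ i, x i ∈ Icc (0:ℝ) L) ∧ ∀ a b : α, r a b ↔ x a + 1 < x b}

lemma boxSet_ne_top {α : Type*} [Fintype α] (L : ℝ) (s : Set (α → ℝ))
    (hs : ∀ x ∈ s, ∀ i, x i ∈ Icc (0:ℝ) L) : volume s ≠ ⊤ := by
  have h1 : s ⊆ pi univ (fun _ : α => Icc (0:ℝ) L) := fun x hx i _ => hs x hx i
  refine ne_top_of_le_ne_top ?_ (measure_mono h1)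
  rw [volume_pi_pi]
  refine ENNReal.prod_ne_top fun i _ => ?_
  simp

lemma labSet_ne_top {α : Type*} [Fintype α] (r : α → α → Prop) (L : ℝ) :
    volume (labSet r L) ≠ ⊤ := boxSet_ne_top L _ fun _ hx => hx.1

lemma labSet_le_genVol {α : Type*} [Fintype α] (r : α → α → Prop) (L : ℝ) :
    (volume (labSet r L)).toReal ≤ genVol r L := by
  refine ENNReal.toReal_mono (boxSet_ne_top L _ fun _ hx => hx.1) (measure_mono ?_)
  intro x hx
  exact ⟨hx.1, Equiv.refl _, hx.2⟩

lemma volume_perm {α : Type*} [Fintype α] (e : α ≃ α) (s : Set (α → ℝ)) :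
    volume {x : α → ℝ | (fun a => x (e a)) ∈ s} = volume s := by
  have h := (volume_measurePreserving_piCongrLeft (fun _ : α => ℝ) e.symm).measure_preimage_equiv s
  rw [← h]
  congr 1
  ext x
  have hx : MeasurableEquiv.piCongrLeft (fun _ : α => ℝ) e.symm x = fun a => x (e a) := by
    ext a
    have := MeasurableEquiv.piCongrLeft_apply_apply e.symm (β := fun _ : α => ℝ) x (e a)
    rwa [Equiv.symm_apply_apply] at this
  rw [mem_preimage, hx]
  rfl

lemma genVol_le_labSet {α : Type*} [Fintype α] (r : α → α → Prop) :
    ∃ N : ℝ, 0 < N ∧ ∀ L, genVol r L ≤ N * (volume (labSet r L)).toReal := by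
  classical
  refine ⟨Fintype.card (α ≃ α), by exact_mod_cast Fintype.card_pos, fun L => ?_⟩
  have h1 : {x : α → ℝ | (∀ i, x i ∈ Icc (0:ℝ) L) ∧
      ∃ e : α ≃ α, ∀ a b : α, r a b ↔ x (e a) + 1 < x (e b)} ⊆
      ⋃ e : α ≃ α, {x : α → ℝ | (fun a => x (e a)) ∈ labSet r L} := by
    rintro x ⟨hx, e, he⟩
    exact mem_iUnion.2 ⟨e, fun i => hx _, he⟩
  have h2 := (measure_mono h1).trans (measure_iUnion_fintype_le volume _)
  simp only [volume_perm, Finset.sum_const, Finset.card_univ, nsmul_eq_mul] at h2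
  have h3 := ENNReal.toReal_mono
    (ENNReal.mul_ne_top (ENNReal.natCast_ne_top _) (labSet_ne_top r L)) h2
  rw [ENNReal.toReal_mul, ENNReal.toReal_natCast] at h3
  exact h3

lemma volume_sigma {k : ℕ} (P : Fin k → Type) [∀ i, Fintype (P i)]
    (B : ∀ i, Set (P i → ℝ)) :
    volume {x : (Σ i, P i) → ℝ | ∀ i, (fun a => x ⟨i, a⟩) ∈ B i} = ∏ i, volume (B i) := by
  have h : MeasurePreserving (MeasurableEquiv.piCurry (fun (i : Fin k) (_ : P i) => ℝ)).symm
      volume volume := by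
    refine ⟨MeasurableEquiv.measurable _, ?_⟩
    symm
    refine Measure.pi_eq fun s hs => ?_
    rw [MeasurableEquiv.map_apply]
    have : (MeasurableEquiv.piCurry (fun (i : Fin k) (_ : P i) => ℝ)).symm ⁻¹' (pi univ s)
        = pi univ (fun i => pi univ (fun a => s ⟨i, a⟩)) := by
      ext x
      simp only [mem_preimage, Set.mem_pi, mem_univ, forall_const, MeasurableEquiv.coe_piCurry_symm,
        Sigma.forall]
      rfl
    rw [this, volume_pi_pi]
    simp only [volume_pi_pi, Fintype.prod_sigma]
  have h2 := h.symm.measure_preimage_equiv (pi univ B)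
  rw [volume_pi_pi] at h2
  rw [← h2]
  congr 1
  ext x
  simp only [mem_preimage, Set.mem_pi, mem_univ, forall_const, mem_ofPred_eq]
  rfl

lemma volume_sigmaLex {k : ℕ} (P : Fin k → Type) [∀ i, Fintype (P i)]
    (B : ∀ i, Set (P i → ℝ)) :
    volume {x : (Σₗ i, P i) → ℝ | ∀ i, (fun a => x (toLex ⟨i, a⟩)) ∈ B i} = ∏ i, volume (B i) :=
  volume_sigma P B

lemma lex_lt_same {k : ℕ} (P : Fin k → Type) [∀ i, PartialOrder (P i)] (i : Fin k) (a b : P i) :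
    ((toLex ⟨i, a⟩ : Σₗ i, P i) < toLex ⟨i, b⟩) ↔ a < b := by
  rw [Sigma.Lex.lt_def]
  constructor
  · rintro (h | ⟨_, h⟩)
    · exact absurd h (lt_irrefl i)
    · exact h
  · intro h
    exact Or.inr ⟨rfl, h⟩

lemma lex_lt_diff {k : ℕ} (P : Fin k → Type) [∀ i, PartialOrder (P i)] (i j : Fin k) (hij : i ≠ j)
    (a : P i) (b : P j) :
    ((toLex ⟨i, a⟩ : Σₗ i, P i) < toLex ⟨j, b⟩) ↔ i < j := by
  rw [Sigma.Lex.lt_def]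
  constructor
  · rintro (h | ⟨h, _⟩)
    · exact h
    · exact absurd h hij
  · intro h
    exact Or.inl h

lemma lab_upper {k : ℕ} (P : Fin k → Type) [∀ i, Fintype (P i)] [∀ i, PartialOrder (P i)]
    (L : ℝ) : (volume (labSet (fun x y : Σₗ i, P i => x < y) L)).toReal ≤
      ∏ i, (volume (labSet (fun x y : P i => x < y) L)).toReal := by
  rw [← ENNReal.toReal_prod, ← volume_sigmaLex]
  refine ENNReal.toReal_mono ?_ (measure_mono ?_)
  · rw [volume_sigmaLex]
    exact ENNReal.prod_ne_top fun i _ => labSet_ne_top _ _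
  · intro x hx i
    refine ⟨fun a => hx.1 _, fun a b => ?_⟩
    rw [← hx.2]
    exact (lex_lt_same P i a b).symm

lemma lab_lower {k : ℕ} (P : Fin k → Type) [∀ i, Fintype (P i)] [∀ i, PartialOrder (P i)]
    (L M : ℝ) (hM : 0 ≤ M) (hL : k * (M + 2) ≤ L) :
    ∏ i, (volume (labSet (fun x y : P i => x < y) M)).toReal ≤
      (volume (labSet (fun x y : Σₗ i, P i => x < y) L)).toReal := by
  have h0 : ∀ i : Fin k, volume ((fun y : P i → ℝ => y + fun _ => -((i:ℕ) * (M + 2))) ⁻¹'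
      labSet (fun x y : P i => x < y) M) = volume (labSet (fun x y : P i => x < y) M) := by
    intro i
    exact measure_preimage_add_right _ _ _
  rw [← ENNReal.toReal_prod]
  simp only [← h0]
  rw [← volume_sigmaLex]
  refine ENNReal.toReal_mono (labSet_ne_top _ _) (measure_mono ?_)
  intro x hx
  have key : ∀ (i : Fin k) (a : P i), (i:ℕ) * (M + 2) ≤ x (toLex ⟨i, a⟩) ∧
      x (toLex ⟨i, a⟩) ≤ (i:ℕ) * (M + 2) + M := by
    intro i a
    have := (hx i).1 a
    simp only [Pi.add_apply, mem_Icc] at this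
    constructor <;> linarith [this.1, this.2]
  have step : ∀ i j : ℕ, i < j → (i:ℝ) * (M + 2) + (M + 2) ≤ j * (M + 2) := by
    intro i j hij
    have : (i:ℝ) + 1 ≤ j := by exact_mod_cast hij
    nlinarith
  constructor
  · rintro ⟨i, a⟩
    have h1 := key i a
    have h2 := step i k i.2
    have h3 : (0:ℝ) ≤ (i:ℕ) * (M + 2) := by positivity
    exact ⟨h3.trans h1.1, by have := h1.2; change x (toLex ⟨i, a⟩) ≤ L; linarith⟩
  · rintro ⟨i, a⟩ ⟨j, b⟩
    change (toLex ⟨i, a⟩ : Σₗ i, P i) < toLex ⟨j, b⟩ ↔ x (toLex ⟨i, a⟩) + 1 < x (toLex ⟨j, b⟩)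
    have hi := key i a
    have hj := key j b
    rcases lt_trichotomy i j with h | h | h
    · rw [lex_lt_diff P i j h.ne]
      have := step i j h
      exact ⟨fun _ => by linarith [hi.2, hj.1], fun _ => h⟩
    · subst h
      rw [lex_lt_same]
      have := (hx i).2 a b
      simp only [Pi.add_apply] at this
      rw [this]
      constructor <;> intro h <;> linarith
    · rw [lex_lt_diff P i j h.ne']
      have := step j i h
      exact ⟨fun h' => absurd h h'.not_gt, fun h' => by linarith [hi.1, hj.2]⟩

/-- For a lexicographic sum `P` of semiorders `P₁, …, P_k` over the `k`-chain with
`V_{P_i}(L) ~ c_i L^{e_i}`, one has `V_P(L) = Θ(L^{e₁+⋯+e_k})`. -/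
theorem lex_sum_volume_theta (k : ℕ) (hk : 1 ≤ k)
    (P : Fin k → Type) [∀ i, Fintype (P i)] [∀ i, PartialOrder (P i)]
    (hsem : ∀ i, IsSemiorder (P i))
    (c : Fin k → ℝ) (hc : ∀ i, 0 < c i)
    (e : Fin k → ℕ) (he : ∀ i, 1 ≤ e i)
    (hlim : ∀ i, Tendsto (fun L : ℝ => genVol (fun a b : P i => a < b) L / L ^ (e i))
      atTop (nhds (c i))) :
    ∃ a b L₀ : ℝ, 0 < a ∧ a ≤ b ∧ ∀ L ≥ L₀,
      a * L ^ (∑ i, e i) ≤ genVol (fun x y : Σₗ i, P i => x < y) L ∧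
      genVol (fun x y : Σₗ i, P i => x < y) L ≤ b * L ^ (∑ i, e i) := by
  have hk' : (1:ℝ) ≤ k := by exact_mod_cast hk
  have hev : ∀ᶠ L : ℝ in atTop, ∀ i,
      c i / 2 * L ^ e i ≤ genVol (fun a b : P i => a < b) L ∧
      genVol (fun a b : P i => a < b) L ≤ 2 * c i * L ^ e i := by
    rw [eventually_all]
    intro i
    have h1 := (hlim i).eventually (lt_mem_nhds (show c i / 2 < c i by linarith [hc i]))
    have h2 := (hlim i).eventually (gt_mem_nhds (show c i < 2 * c i by linarith [hc i]))
    filter_upwards [h1, h2, eventually_gt_atTop 0] with L h1 h2 h3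
    have h4 : 0 < L ^ e i := by positivity
    exact ⟨((lt_div_iff₀ h4).1 h1).le, ((div_lt_iff₀ h4).1 h2).le⟩
  obtain ⟨A, hA⟩ := eventually_atTop.1 hev
  obtain ⟨N, hN, hgN⟩ := genVol_le_labSet (fun x y : Σₗ i, P i => x < y)
  choose n hn hgn using fun i => genVol_le_labSet (fun a b : P i => a < b)
  set a : ℝ := ∏ i, (c i / 2 / n i * (1 / (2 * k)) ^ e i) with ha
  set b : ℝ := N * ∏ i, (2 * c i) with hb
  have ha0 : 0 < a := Finset.prod_pos fun i _ => by
    have := hc i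
    have := hn i
    positivity
  refine ⟨a, max a b, max (4 * k) (max A (2 * k * A)), ha0, le_max_left _ _, fun L hL => ?_⟩
  have hL1 : 4 * (k:ℝ) ≤ L := (le_max_left _ _).trans hL
  have hL2 : A ≤ L := ((le_max_left _ _).trans (le_max_right _ _)).trans hL
  have hL3 : 2 * k * A ≤ L := ((le_max_right _ _).trans (le_max_right _ _)).trans hL
  have hL0 : 0 < L := by linarith
  constructor
  · have hM1 : 1 / (2 * k) * L ≤ L / k - 2 := by
      have h2 : 4 ≤ L / k := by rw [le_div_iff₀ (by linarith)]; exact hL1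
      have h3 : 1 / (2 * k) * L = (L / k) / 2 := by field_simp
      rw [h3]; linarith
    have hMA : A ≤ 1 / (2 * k) * L := by
      have h3 : 1 / (2 * k) * L = L / (2 * k) := by ring
      rw [h3, le_div_iff₀ (by linarith)]; linarith
    have hM0 : 0 ≤ 1 / (2 * k) * L := by positivity
    refine le_trans ?_ ((lab_lower P L (L / k - 2) (hM0.trans hM1) (le_of_eq ?_)).trans
      (labSet_le_genVol _ _))
    · rw [ha, ← Finset.prod_pow_eq_pow_sum, ← Finset.prod_mul_distrib]
      refine Finset.prod_le_prod (fun i _ => ?_) fun i _ => ?_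
      · have := hc i
        have := hn i
        positivity
      · have h1 := (hA (L / k - 2) (hMA.trans hM1) i).1
        have h2 := hgn i (L / k - 2)
        have h3 : (1 / (2 * k) * L) ^ e i ≤ (L / k - 2) ^ e i := pow_le_pow_left₀ hM0 hM1 _
        have h4 : c i / 2 * (1 / (2 * k) * L) ^ e i ≤ c i / 2 * (L / k - 2) ^ e i :=
          mul_le_mul_of_nonneg_left h3 (by linarith [hc i])
        have h5 := (h4.trans h1).trans h2
        have h6 : c i / 2 / n i * (1 / (2 * k)) ^ e i * L ^ e i
            = (c i / 2 * (1 / (2 * k) * L) ^ e i) / n i := by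
          rw [mul_pow]; ring
        rw [h6, div_le_iff₀ (hn i), mul_comm _ (n i)]
        exact h5
    · have : (k:ℝ) ≠ 0 := by linarith
      field_simp
      ring
  · have h1 : genVol (fun x y : Σₗ i, P i => x < y) L ≤ b * L ^ (∑ i, e i) := by
      refine (hgN L).trans ?_
      rw [hb, mul_assoc]
      refine mul_le_mul_of_nonneg_left ((lab_upper P L).trans ?_) hN.le
      rw [← Finset.prod_pow_eq_pow_sum, ← Finset.prod_mul_distrib]
      exact Finset.prod_le_prod (fun i _ => ENNReal.toReal_nonneg) fun i _ =>
        (labSet_le_genVol _ _).trans (hA L hL2 i).2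
    exact h1.trans (mul_le_mul_of_nonneg_right (le_max_right _ _) (by positivity))
end

section
/- For every integer n ≥ 2 and every real L ≥ 0, the n-dimensional Lebesgue measure of the set {x ∈ ℝⁿ : 0 ≤ x₁ ≤ L, x₁ ≤ x₂ ≤ x₁ + 1, and x_{i−2} + 1 ≤ x_i ≤ x_{i−1} + 1 for all 3 ≤ i ≤ n} equals (A_{n−1}/(n−1)!)·L, where A_{n−1} is the number of down-up alternating permutations of {1,…,n−1} (with A_0 = 1). -/
open MeasureTheory Set

/-- `altCount m` is the number of down-up alternating permutations of `{1, …, m}`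
(`σ 1 > σ 2 < σ 3 > ⋯`), i.e. the Euler up/down number `A_m`. -/
noncomputable def altCount (m : ℕ) : ℕ :=
  Nat.card {σ : Equiv.Perm (Fin m) //
    ∀ i : Fin m, ∀ h : i.val + 1 < m,
      if i.val % 2 = 0 then σ ⟨i.val + 1, h⟩ < σ i else σ i < σ ⟨i.val + 1, h⟩}

namespace LadderAux

def cube (m : ℕ) : Set (Fin m → ℝ) := Set.Icc (fun _ => 0) (fun _ => 1)

def T {m : ℕ} (τ : Equiv.Perm (Fin m)) : Set (Fin m → ℝ) :=
  {z | z ∈ cube m ∧ ∀ i j, i < j → z (τ.symm i) < z (τ.symm j)}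

def Alt {m : ℕ} (σ : Equiv.Perm (Fin m)) : Prop :=
  ∀ i : Fin m, ∀ h : i.val + 1 < m,
      if i.val % 2 = 0 then σ ⟨i.val + 1, h⟩ < σ i else σ i < σ ⟨i.val + 1, h⟩

def D (m : ℕ) : Set (Fin m → ℝ) :=
  {z | z ∈ cube m ∧ ∀ i : Fin m, ∀ h : i.val + 1 < m,
      if i.val % 2 = 0 then z ⟨i.val + 1, h⟩ ≤ z i else z i ≤ z ⟨i.val + 1, h⟩}

lemma measurableSet_cube (m : ℕ) : MeasurableSet (cube m) := measurableSet_Icc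

lemma measurableSet_T {m : ℕ} (τ : Equiv.Perm (Fin m)) : MeasurableSet (T τ) := by
  have : T τ = cube m ∩ ⋂ i, ⋂ j, ⋂ (_ : i < j), {z | z (τ.symm i) < z (τ.symm j)} := by
    ext z; simp [T]
  rw [this]
  refine (measurableSet_cube m).inter ?_
  refine MeasurableSet.iInter fun i => MeasurableSet.iInter fun j => MeasurableSet.iInter fun _ => ?_
  exact measurableSet_lt (measurable_pi_apply _) (measurable_pi_apply _)

lemma volume_cube (m : ℕ) : volume (cube m) = 1 := by
  simp [cube, Real.volume_Icc_pi]

lemma volume_T {m : ℕ} (τ : Equiv.Perm (Fin m)) : volume (T τ) = volume (T (1 : Equiv.Perm (Fin m))) := by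
  have h := (volume_measurePreserving_piCongrLeft (fun _ : Fin m => ℝ) τ)
  rw [← h.measure_preimage (measurableSet_T 1).nullMeasurableSet]
  congr 1
  ext z
  have key : ∀ i, (MeasurableEquiv.piCongrLeft (fun _ : Fin m => ℝ) τ) z i = z (τ.symm i) := by
    intro i
    obtain ⟨j, rfl⟩ := τ.surjective i
    rw [MeasurableEquiv.coe_piCongrLeft, Equiv.piCongrLeft_apply_apply]; simp
  have h1 : (∀ i, 0 ≤ z (τ.symm i)) ↔ ∀ i, 0 ≤ z i :=
    τ.symm.forall_congr_right (q := fun i => 0 ≤ z i)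
  have h2 : (∀ i, z (τ.symm i) ≤ 1) ↔ ∀ i, z i ≤ 1 :=
    τ.symm.forall_congr_right (q := fun i => z i ≤ 1)
  simp only [T, cube, Set.mem_Icc, Pi.le_def, mem_ofPred_eq, mem_preimage, key, h1, h2]
  exact Iff.rfl

def Bad (m : ℕ) : Set (Fin m → ℝ) := ⋃ i, ⋃ j, ⋃ (_ : i ≠ j), {z | z i = z j}

lemma volume_Bad (m : ℕ) : volume (Bad m) = 0 := by
  refine measure_iUnion_null fun i => measure_iUnion_null fun j => measure_iUnion_null fun hij => ?_
  let f : (Fin m → ℝ) →ₗ[ℝ] ℝ := LinearMap.proj (R := ℝ) (φ := fun _ : Fin m => ℝ) i - LinearMap.proj (R := ℝ) (φ := fun _ : Fin m => ℝ) j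
  have : {z : Fin m → ℝ | z i = z j} = (LinearMap.ker f : Set (Fin m → ℝ)) := by
    ext z; simp [f, sub_eq_zero]
  rw [this]
  apply Measure.addHaar_submodule
  intro h
  have : Pi.single i (1:ℝ) ∈ LinearMap.ker f := by rw [h]; trivial
  simp [f, hij.symm] at this

lemma inj_of_not_bad {m : ℕ} {z : Fin m → ℝ} (h : z ∉ Bad m) : Function.Injective z := by
  intro i j hij
  by_contra hne
  exact h (by simp only [Bad, mem_iUnion]; exact ⟨i, j, hne, hij⟩)

lemma exists_T {m : ℕ} {z : Fin m → ℝ} (hz : z ∈ cube m) (h : z ∉ Bad m) : ∃ τ, z ∈ T τ := by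
  refine ⟨(Tuple.sort z).symm, hz, ?_⟩
  have := (Tuple.monotone_sort z).strictMono_of_injective
    ((inj_of_not_bad h).comp (Tuple.sort z).injective)
  intro i j hij
  exact this hij

lemma T_lt {m : ℕ} {z : Fin m → ℝ} {τ : Equiv.Perm (Fin m)} (hz : z ∈ T τ) {i j : Fin m} :
    z i < z j ↔ τ i < τ j := by
  have : StrictMono (z ∘ τ.symm) := fun i j hij => hz.2 i j hij
  have := this.lt_iff_lt (a := τ i) (b := τ j)
  simpa using this

lemma T_le {m : ℕ} {z : Fin m → ℝ} {τ : Equiv.Perm (Fin m)} (hz : z ∈ T τ) {i j : Fin m} :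
    z i ≤ z j ↔ τ i ≤ τ j := by
  rw [← not_lt, ← not_lt, T_lt hz]

lemma disj {m : ℕ} : Pairwise (Function.onFun Disjoint (T (m := m))) := by
  intro σ τ hne
  refine Set.disjoint_left.2 fun z h1 h2 => hne ?_
  have hs : StrictMono (fun i => σ (τ.symm i)) := by
    intro i j hij
    rw [← T_lt h1]; exact h2.2 i j hij
  have : (τ.symm.trans σ) = 1 := by
    have h3 := Subsingleton.elim (hs.orderIsoOfSurjective _ (τ.symm.trans σ).surjective) (OrderIso.refl _)
    ext i
    have h4 : σ (τ.symm i) = i := congrArg (fun f : Fin m ≃o Fin m => f i) h3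
    exact congrArg Fin.val h4
  ext i
  have := congrArg (fun f => f (τ i)) this
  simp at this
  rw [this]

lemma volume_T_one (m : ℕ) : (m.factorial : ENNReal) * volume (T (1 : Equiv.Perm (Fin m))) = 1 := by
  have h1 : volume (⋃ τ : Equiv.Perm (Fin m), T τ) = 1 := by
    rw [← volume_cube m]
    apply le_antisymm
    · exact measure_mono (iUnion_subset fun τ z hz => hz.1)
    · rw [← measure_sdiff_null (volume_Bad m)]
      refine measure_mono ?_
      rintro z ⟨hz, hb⟩
      exact mem_iUnion.2 (exists_T hz hb)
  rw [measure_iUnion disj measurableSet_T, tsum_fintype] at h1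
  simp only [volume_T] at h1
  simpa [Fintype.card_perm] using h1

lemma volume_D (m : ℕ) : volume (D m) = ENNReal.ofReal ((altCount m : ℝ) / (m.factorial : ℝ)) := by
  classical
  have h1 : volume (⋃ τ : {σ : Equiv.Perm (Fin m) // Alt σ}, T τ.1) = volume (D m) := by
    apply le_antisymm
    · refine measure_mono (iUnion_subset fun τ z hz => ⟨hz.1, fun i h => ?_⟩)
      have := τ.2 i h
      split_ifs with hi
      · rw [if_pos hi] at this; exact ((T_lt hz).2 this).le
      · rw [if_neg hi] at this; exact ((T_lt hz).2 this).le
    · rw [← measure_sdiff_null (volume_Bad m)]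
      refine measure_mono ?_
      rintro z ⟨hz, hb⟩
      obtain ⟨τ, hτ⟩ := exists_T hz.1 hb
      refine mem_iUnion.2 ⟨⟨τ, fun i h => ?_⟩, hτ⟩
      have := hz.2 i h
      have hne : i ≠ ⟨i.val + 1, h⟩ := by
        intro h'; have := congrArg Fin.val h'; simp at this
      split_ifs with hi
      · rw [if_pos hi] at this
        exact lt_of_le_of_ne ((T_le hτ).1 this) (fun h' => hne (τ.injective h').symm)
      · rw [if_neg hi] at this
        exact lt_of_le_of_ne ((T_le hτ).1 this) (fun h' => hne (τ.injective h'))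
  have hdis : Pairwise (Function.onFun Disjoint
      (fun τ : {σ : Equiv.Perm (Fin m) // Alt σ} => T τ.1)) :=
    fun a b hab => disj (fun h => hab (Subtype.ext h))
  rw [← h1, measure_iUnion hdis
    (fun τ => measurableSet_T τ.1), tsum_fintype]
  simp only [volume_T]
  have h2 : volume (T (1 : Equiv.Perm (Fin m))) = (m.factorial : ENNReal)⁻¹ :=
    ENNReal.eq_inv_of_mul_eq_one_left (by rw [mul_comm]; exact volume_T_one m)
  have h3 : altCount m = Fintype.card {σ : Equiv.Perm (Fin m) // Alt σ} := by
    rw [← Nat.card_eq_fintype_card]; rfl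
  rw [h2, h3, ENNReal.ofReal_div_of_pos (by positivity)]
  simp [div_eq_mul_inv]

def sgn (k : ℕ) : ℝ := if k % 2 = 0 then 1 else -1

def f (m : ℕ) : (Fin (m+1) → ℝ) →ₗ[ℝ] (Fin (m+1) → ℝ) where
  toFun x := Fin.cons (x 0) (fun k : Fin m => sgn k * (x k.succ - x k.castSucc))
  map_add' x y := by
    ext i; refine Fin.cases ?_ (fun k => ?_) i <;> simp; ring
  map_smul' c x := by
    ext i; refine Fin.cases ?_ (fun k => ?_) i <;> simp; ring

lemma det_f (m : ℕ) : |LinearMap.det (f m)| = 1 := by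
  rw [← LinearMap.det_toMatrix', Matrix.det_of_isLowerTriangular, Finset.abs_prod]
  · apply Finset.prod_eq_one
    intro i _
    rw [LinearMap.toMatrix'_apply]
    refine Fin.cases ?_ (fun k => ?_) i
    · simp [f]
    · have : k.castSucc ≠ k.succ := k.castSucc_lt_succ.ne
      simp [f, Pi.single_apply, this, sgn]
      split_ifs <;> simp
  · intro i j hij
    replace hij : i < j := hij
    rw [LinearMap.toMatrix'_apply]
    revert hij
    refine Fin.cases ?_ (fun k => ?_) i
    · intro h; simp [f, Pi.single_apply, h.ne]
    · intro h
      have h1 := h.ne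
      have h2 := (k.castSucc_lt_succ.trans h).ne
      simp [f, Pi.single_apply, h1, h2]

def c (m : ℕ) : Fin (m+1) → ℝ := Fin.cons 0 (fun k : Fin m => if k.val % 2 = 0 then 0 else 1)

lemma volume_pre (m : ℕ) (s : Set (Fin (m+1) → ℝ)) :
    volume {x | f m x + c m ∈ s} = volume s := by
  have h : {x | f m x + c m ∈ s} = f m ⁻¹' ((fun y => y + c m) ⁻¹' s) := rfl
  have hd := det_f m
  rw [h, Measure.addHaar_preimage_linearMap, measure_preimage_add_right, abs_inv, hd]
  · simp
  · intro h0; simp [h0] at hd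

lemma volume_prod (m : ℕ) (L : ℝ) :
    volume {y : Fin (m+1) → ℝ | y 0 ∈ Set.Icc 0 L ∧ Fin.tail y ∈ D m} =
      ENNReal.ofReal L * volume (D m) := by
  have h := volume_preserving_piFinSuccAbove (fun _ : Fin (m+1) => ℝ) 0
  have h2 := h.measure_preimage_equiv (Set.Icc 0 L ×ˢ D m)
  rw [Measure.volume_eq_prod, Measure.prod_prod, Real.volume_Icc, sub_zero] at h2
  rw [← h2]
  congr 1

lemma region (m : ℕ) (hm : 1 ≤ m) (x : Fin (m+1) → ℝ) (L : ℝ) :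
    (0 ≤ x ⟨0, by omega⟩ ∧ x ⟨0, by omega⟩ ≤ L ∧
        x ⟨0, by omega⟩ ≤ x ⟨1, by omega⟩ ∧ x ⟨1, by omega⟩ ≤ x ⟨0, by omega⟩ + 1 ∧
        ∀ i : Fin (m+1), 2 ≤ i.val →
          x ⟨i.val - 2, lt_of_le_of_lt (Nat.sub_le _ _) i.isLt⟩ + 1 ≤ x i ∧
          x i ≤ x ⟨i.val - 1, lt_of_le_of_lt (Nat.sub_le _ _) i.isLt⟩ + 1) ↔
    ((f m x + c m) 0 ∈ Set.Icc 0 L ∧ Fin.tail (f m x + c m) ∈ D m) := by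
  have e0 : (f m x + c m) 0 = x ⟨0, by omega⟩ := by simp [f, c]
  have e1 : ∀ k : Fin m, Fin.tail (f m x + c m) k =
      if k.val % 2 = 0 then x ⟨k.val + 1, by omega⟩ - x ⟨k.val, by omega⟩
      else 1 - (x ⟨k.val + 1, by omega⟩ - x ⟨k.val, by omega⟩) := by
    intro k
    have a1 : k.succ = ⟨k.val + 1, by omega⟩ := rfl
    have a2 : k.castSucc = ⟨k.val, by omega⟩ := rfl
    simp only [Fin.tail, f, c, sgn, Pi.add_apply, LinearMap.coe_mk, AddHom.coe_mk, Fin.cons_succ]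
    rw [a1, a2]
    split_ifs <;> ring
  rw [e0]
  simp only [D, cube, Set.mem_Icc, Pi.le_def, mem_ofPred_eq, e1]
  constructor
  · rintro ⟨h0, hL, h1, h2, h3⟩
    have step : ∀ k (hk : k < m), 0 ≤ x ⟨k + 1, by omega⟩ - x ⟨k, by omega⟩ ∧
        x ⟨k + 1, by omega⟩ - x ⟨k, by omega⟩ ≤ 1 := by
      intro k hk
      induction k with
      | zero => simp only [zero_add]; constructor <;> linarith
      | succ k ih =>
        have a := ih (by omega)
        have b := h3 ⟨k + 2, by omega⟩ (by simp)
        simp only [Nat.add_sub_cancel, show k + 2 - 1 = k + 1 by omega] at b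
        simp only [show k + 1 + 1 = k + 2 by omega]
        constructor <;> linarith [b.1, b.2, a.1, a.2]
    refine ⟨⟨h0, hL⟩, ⟨fun k => ?_, fun k => ?_⟩, fun k h => ?_⟩
    · have := step k k.2; split_ifs <;> linarith [this.1, this.2]
    · have := step k k.2; split_ifs <;> linarith [this.1, this.2]
    · have b := (h3 ⟨k + 2, by omega⟩ (by simp)).1
      simp only [Nat.add_sub_cancel] at b
      simp only [show k.val + 1 + 1 = k.val + 2 by omega]
      split_ifs <;> first | omega | linarith
  · rintro ⟨⟨h0, hL⟩, ⟨h1, h2⟩, h3⟩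
    have a1 := h1 ⟨0, by omega⟩
    have a2 := h2 ⟨0, by omega⟩
    simp only [Nat.zero_mod, if_true, zero_add] at a1 a2
    refine ⟨h0, hL, by linarith, by linarith, ?_⟩
    rintro ⟨i, hi⟩ h
    obtain ⟨k, rfl⟩ : ∃ k, i = k + 2 := ⟨i - 2, by simp at h; omega⟩
    have b1 := h1 ⟨k + 1, by omega⟩
    have b2 := h2 ⟨k + 1, by omega⟩
    have b3 := h3 ⟨k, by omega⟩ (by simp; omega)
    simp only [Nat.add_sub_cancel, show k + 2 - 1 = k + 1 by omega]
    simp only [show k + 1 + 1 = k + 2 by omega] at b1 b2 b3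
    split_ifs at b1 b2 b3 <;> first | omega | (constructor <;> linarith)

end LadderAux



/-- The region of integration defining the probability of generating the ladder on
`n` elements has volume `(A_{n-1}/(n-1)!)·L`. -/
theorem volume_ladder_region (n : ℕ) (hn : 2 ≤ n) (L : ℝ) (hL : 0 ≤ L) :
    volume {x : Fin n → ℝ |
        0 ≤ x ⟨0, by omega⟩ ∧ x ⟨0, by omega⟩ ≤ L ∧
        x ⟨0, by omega⟩ ≤ x ⟨1, by omega⟩ ∧ x ⟨1, by omega⟩ ≤ x ⟨0, by omega⟩ + 1 ∧
        ∀ i : Fin n, 2 ≤ i.val →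
          x ⟨i.val - 2, lt_of_le_of_lt (Nat.sub_le _ _) i.isLt⟩ + 1 ≤ x i ∧
          x i ≤ x ⟨i.val - 1, lt_of_le_of_lt (Nat.sub_le _ _) i.isLt⟩ + 1}
      = ENNReal.ofReal (((altCount (n - 1) : ℝ) / (Nat.factorial (n - 1) : ℝ)) * L) := by
  obtain ⟨m, rfl⟩ : ∃ m, n = m + 1 := ⟨n - 1, by omega⟩
  have h := LadderAux.volume_pre m {y | y 0 ∈ Set.Icc 0 L ∧ Fin.tail y ∈ LadderAux.D m}
  rw [LadderAux.volume_prod, LadderAux.volume_D, ← ENNReal.ofReal_mul hL, mul_comm] at h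
  rw [Nat.add_sub_cancel, ← h]
  congr 1
  ext x
  exact LadderAux.region m (by omega) x L
end
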